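/- arXiv:2411.13969 — 2 statements merged into one kernel-verified Lean document; each statement's English description precedes it below -/
import Mathlib

section
/- Let V ∈ C(X×Y) be nonnegative, κ > 0, τ > 0, ν a probability measure on Y, μ a probability measure on X absolutely continuous with respect to Lebesgue measure, and ρ̄ ∈ Γ(μ,ν). Then the infimum over ρ ∈ Γ(μ,ν) of E_τ(ρ|ρ̄) := (1/2τ) W_F(ρ,ρ̄)² + ∫ V dρ + κ H(ρ|ν) equals the infimum, over nonnegative measures γ on X×X×Y whose pushforward under (x,x',y)↦x equals μ and whose pushforward under (x,x',y)↦(x',y) equals ρ̄, of ∫ ( |x−x'|²/(2τ) + V(x,y) ) dγ(x,x',y) + κ H(P₁₃γ | ν), where P₁₃γ is the pushforward of γ under (x,x',y)↦(x,y); moreover, if γ minimizes the latter problem then P₁₃γ minimizes E_τ(·|ρ̄) over Γ(μ,ν). -/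
open MeasureTheory ProbabilityTheory Filter Set
open scoped ENNReal Topology

noncomputable section

abbrev Euc (n : ℕ) : Type := EuclideanSpace ℝ (Fin n)

/-- The set of couplings (transport plans) between two measures. -/
def Couplings {α β : Type*} [MeasurableSpace α] [MeasurableSpace β]
    (μ : Measure α) (ν : Measure β) : Set (Measure (α × β)) :=
  {γ | IsProbabilityMeasure γ ∧ γ.map Prod.fst = μ ∧ γ.map Prod.snd = ν}

/-- Optimal transport cost between two measures for cost `c`. -/
def transportCost {α β : Type*} [MeasurableSpace α] [MeasurableSpace β]
    (c : α → β → ℝ≥0∞) (μ : Measure α) (ν : Measure β) : ℝ≥0∞ :=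
  ⨅ γ ∈ Couplings μ ν, ∫⁻ p, c p.1 p.2 ∂γ

/-- Squared 2-Wasserstein distance. -/
noncomputable def W2sq {α : Type*} [MeasurableSpace α] [PseudoEMetricSpace α]
    (μ ν : Measure α) : ℝ≥0∞ :=
  transportCost (fun a b => edist a b ^ 2) μ ν

/-- `K` is the disintegration of `ρ` with respect to its second marginal `ν`. -/
def IsDisint {α β : Type*} [MeasurableSpace α] [MeasurableSpace β]
    (ν : Measure β) (ρ : Measure (α × β)) (K : Kernel β α) : Prop :=
  IsMarkovKernel K ∧
    ∀ s : Set α, ∀ t : Set β, MeasurableSet s → MeasurableSet t →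
      ρ (s ×ˢ t) = ∫⁻ y in t, K y s ∂ν

/-- Squared fibered Wasserstein distance `W_F(ρ₁,ρ₂)² = ∫_Y W(ρ_{1,y},ρ_{2,y})² dν(y)`,
expressed through the (a.e.-unique) disintegrations of `ρ₁, ρ₂` w.r.t. `ν`. -/
noncomputable def WFsq {α β : Type*} [MeasurableSpace α] [PseudoEMetricSpace α]
    [MeasurableSpace β] (ν : Measure β) (ρ₁ ρ₂ : Measure (α × β)) : ℝ≥0∞ :=
  ⨅ (K₁ : Kernel β α) (K₂ : Kernel β α) (_ : IsDisint ν ρ₁ K₁) (_ : IsDisint ν ρ₂ K₂),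
    ∫⁻ y, W2sq (K₁ y) (K₂ y) ∂ν

/-- The integrand `s ↦ s log s − s + 1` of the entropy. -/
def entT (s : ℝ) : ℝ := s * Real.log s - s + 1

open scoped Classical in
/-- Weighted negative entropy of `ρ` relative to the reference measure `π`. -/
noncomputable def entropyH {α : Type*} [MeasurableSpace α] (π ρ : Measure α) : ℝ≥0∞ :=
  if ρ ≪ π then ∫⁻ p, ENNReal.ofReal (entT ((ρ.rnDeriv π p).toReal)) ∂π else ⊤

/-- The reference measure `𝓛|X ⊗ ν` on `X × Y`. -/
noncomputable def Lref {d d' : ℕ} (X : Set (Euc d)) (ν : Measure (Euc d')) :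
    Measure (Euc d × Euc d') :=
  (MeasureTheory.volume.restrict X).prod ν

/-- The minimizing movement functional
`E_τ(ρ | ρ̄) = (1/2τ) W_F(ρ, ρ̄)² + ∫ V dρ + κ H(ρ|ν)`. -/
noncomputable def JKOFun {d d' : ℕ} (X : Set (Euc d)) (ν : Measure (Euc d'))
    (V : Euc d × Euc d' → ℝ) (κ τ : ℝ) (ρbar ρ : Measure (Euc d × Euc d')) : ℝ≥0∞ :=
  ENNReal.ofReal (1 / (2 * τ)) * WFsq ν ρ ρbar
    + (∫⁻ p, ENNReal.ofReal (V p) ∂ρ) + ENNReal.ofReal κ * entropyH (Lref X ν) ρ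

/-- The feasible set of the three-variable primal problem: nonnegative measures `γ` on
`X × X × Y` with `P₁ γ = μ` and `P₂₃ γ = ρ̄`. -/
def PrimalFeas {d d' : ℕ} (μ : Measure (Euc d)) (ρbar : Measure (Euc d × Euc d')) :
    Set (Measure (Euc d × Euc d × Euc d')) :=
  {γ | γ.map (fun p => p.1) = μ ∧ γ.map (fun p => p.2) = ρbar}

/-- The objective of the three-variable primal problem:
`∫ (|x−x'|²/(2τ) + V(x,y)) dγ + κ H(P₁₃ γ | ν)`. -/
noncomputable def PrimalFun {d d' : ℕ} (X : Set (Euc d)) (ν : Measure (Euc d'))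
    (V : Euc d × Euc d' → ℝ) (κ τ : ℝ) (γ : Measure (Euc d × Euc d × Euc d')) : ℝ≥0∞ :=
  (∫⁻ p, (ENNReal.ofReal (1 / (2 * τ)) * edist p.1 p.2.1 ^ 2
      + ENNReal.ofReal (V (p.1, p.2.2))) ∂γ)
    + ENNReal.ofReal κ * entropyH (Lref X ν) (γ.map (fun p => (p.1, p.2.2)))

section Completion

variable {α β Ω : Type*} [MeasurableSpace α] [MeasurableSpace β] [MeasurableSpace Ω]

/-- Density, with respect to `μ ⊗ ν`, of the coupling of `μ` and `ν` obtained from the partial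
coupling with density `w` by transporting the residual masses independently of each other. -/
def completionDensity (μ : Measure α) (ν : Measure β) (w : α × β → ℝ≥0∞) (p : α × β) : ℝ≥0∞ :=
  w p + (1 - ∫⁻ b, w (p.1, b) ∂ν) *
    ((1 - ∫⁻ a, w (a, p.2) ∂μ) / (1 - ∫⁻ z, w z ∂(μ.prod ν)))

/-- The partial coupling with density `w` completed to a coupling. -/
def completion (μ : Measure α) (ν : Measure β) (w : α × β → ℝ≥0∞) : Measure (α × β) :=
  (μ.prod ν).withDensity (completionDensity μ ν w)

lemma measurable_completionDensity_kernel (K : Kernel Ω α) (L : Kernel Ω β) [IsMarkovKernel K]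
    [IsMarkovKernel L] {w : α × β → ℝ≥0∞} (hw : Measurable w) :
    Measurable fun q : Ω × (α × β) => completionDensity (K q.1) (L q.1) w q.2 := by
  have h₁ : Measurable fun q : Ω × (α × β) => ∫⁻ b, w (q.2.1, b) ∂(L q.1) :=
    Measurable.lintegral_kernel_prod_right' (κ := L.comap Prod.fst measurable_fst)
      (f := fun z : (Ω × (α × β)) × β => w (z.1.2.1, z.2)) (by fun_prop)
  have h₂ : Measurable fun q : Ω × (α × β) => ∫⁻ a, w (a, q.2.2) ∂(K q.1) :=
    Measurable.lintegral_kernel_prod_right' (κ := K.comap Prod.fst measurable_fst)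
      (f := fun z : (Ω × (α × β)) × α => w (z.2, z.1.2.2)) (by fun_prop)
  have h₃ : Measurable fun q : Ω × (α × β) => ∫⁻ z, w z ∂((K q.1).prod (L q.1)) := by
    have := (hw.lintegral_kernel (κ := K ×ₖ L)).comp
      (measurable_fst : Measurable (Prod.fst : Ω × (α × β) → Ω))
    simpa only [Function.comp_def, Kernel.prod_apply] using this
  unfold completionDensity
  fun_prop

lemma measurable_completion_kernel (K : Kernel Ω α) (L : Kernel Ω β) [IsMarkovKernel K]
    [IsMarkovKernel L] {w : α × β → ℝ≥0∞} (hw : Measurable w) :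
    Measurable fun y => completion (K y) (L y) w := by
  have h : Measurable (Function.uncurry fun y => completionDensity (K y) (L y) w) :=
    measurable_completionDensity_kernel K L hw
  have heq : (fun y => completion (K y) (L y) w) =
      Kernel.withDensity (K ×ₖ L) fun y => completionDensity (K y) (L y) w := by
    funext y
    rw [Kernel.withDensity_apply _ h, Kernel.prod_apply, completion]
  rw [heq]
  exact Kernel.measurable _

variable {μ : Measure α} {ν : Measure β} [IsProbabilityMeasure μ] [IsProbabilityMeasure ν]
  {w : α × β → ℝ≥0∞}

lemma measurable_completionDensity (hw : Measurable w) :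
    Measurable (completionDensity μ ν w) := by
  have h₁ : Measurable fun a => ∫⁻ b, w (a, b) ∂ν := hw.lintegral_prod_right'
  have h₂ : Measurable fun b => ∫⁻ a, w (a, b) ∂μ := hw.lintegral_prod_left'
  unfold completionDensity
  fun_prop

lemma lintegral_one_sub_eq {f : α → ℝ≥0∞} (hf : Measurable f) (h1 : ∀ a, f a ≤ 1) :
    ∫⁻ a, (1 - f a) ∂μ = 1 - ∫⁻ a, f a ∂μ := by
  have hle : ∫⁻ a, f a ∂μ ≤ 1 := (lintegral_mono h1).trans (by simp)
  rw [lintegral_sub hf (hle.trans_lt ENNReal.one_lt_top).ne (ae_of_all _ h1)]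
  simp

omit [IsProbabilityMeasure ν] in
lemma ae_add_mul_lintegral_div_eq_one {u : α → ℝ≥0∞} {g : β → ℝ≥0∞} (hu : Measurable u)
    (hu1 : ∀ a, u a ≤ 1) (hg : Measurable g) (hug : ∫⁻ b, g b ∂ν = ∫⁻ a, (1 - u a) ∂μ) :
    ∀ᵐ a ∂μ, u a + (1 - u a) * ∫⁻ b, g b / ∫⁻ a, (1 - u a) ∂μ ∂ν = 1 := by
  simp_rw [div_eq_mul_inv, lintegral_mul_const _ hg, hug]
  have hfin : ∫⁻ a, (1 - u a) ∂μ ≠ ⊤ :=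
    ((lintegral_mono fun a => tsub_le_self).trans_lt (by simp : ∫⁻ _, 1 ∂μ < ⊤)).ne
  by_cases h0 : ∫⁻ a, (1 - u a) ∂μ = 0
  · have h := (lintegral_eq_zero_iff (measurable_const.sub hu)).1 h0
    filter_upwards [h] with a ha
    have ha' : 1 - u a = 0 := ha
    rw [ha', zero_mul, add_zero]
    exact le_antisymm (hu1 a) (tsub_eq_zero_iff_le.1 ha')
  · refine ae_of_all _ fun a => ?_
    rw [ENNReal.mul_inv_cancel h0 hfin, mul_one, add_tsub_cancel_of_le (hu1 a)]

lemma completion_mem_couplings (hw : Measurable w) (hu : ∀ a, ∫⁻ b, w (a, b) ∂ν ≤ 1)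
    (hv : ∀ b, ∫⁻ a, w (a, b) ∂μ ≤ 1) : completion μ ν w ∈ Couplings μ ν := by
  have hum : Measurable fun a => ∫⁻ b, w (a, b) ∂ν := hw.lintegral_prod_right'
  have hvm : Measurable fun b => ∫⁻ a, w (a, b) ∂μ := hw.lintegral_prod_left'
  have hdm := measurable_completionDensity (μ := μ) (ν := ν) hw
  have hmu : ∫⁻ a, (1 - ∫⁻ b, w (a, b) ∂ν) ∂μ = 1 - ∫⁻ z, w z ∂(μ.prod ν) := by
    rw [lintegral_one_sub_eq hum hu, lintegral_prod _ hw.aemeasurable]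
  have hmv : ∫⁻ b, (1 - ∫⁻ a, w (a, b) ∂μ) ∂ν = 1 - ∫⁻ z, w z ∂(μ.prod ν) := by
    rw [lintegral_one_sub_eq hvm hv, lintegral_prod_symm _ hw.aemeasurable]
  have h₁ : (completion μ ν w).map Prod.fst = μ := by
    ext s hs
    rw [Measure.map_apply measurable_fst hs, completion, withDensity_apply _ (measurable_fst hs),
      ← prod_univ, ← Measure.prod_restrict, Measure.restrict_univ,
      lintegral_prod _ hdm.aemeasurable]
    have := ae_add_mul_lintegral_div_eq_one hum hu (hvm.const_sub 1) (hmv.trans hmu.symm)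
    rw [hmu] at this
    have h1 : ∀ᵐ a ∂μ, ∫⁻ b, completionDensity μ ν w (a, b) ∂ν = 1 := by
      filter_upwards [this] with a ha
      simp only [completionDensity]
      rw [lintegral_add_left (by fun_prop), lintegral_const_mul _ (by fun_prop), ha]
    rw [lintegral_congr_ae (ae_restrict_of_ae h1)]
    simp
  have h₂ : (completion μ ν w).map Prod.snd = ν := by
    ext s hs
    rw [Measure.map_apply measurable_snd hs, completion, withDensity_apply _ (measurable_snd hs),
      ← univ_prod, ← Measure.prod_restrict, Measure.restrict_univ,
      lintegral_prod_symm _ hdm.aemeasurable]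
    have := ae_add_mul_lintegral_div_eq_one hvm hv (hum.const_sub 1) (hmu.trans hmv.symm)
    rw [hmv] at this
    have h1 : ∀ᵐ b ∂ν, ∫⁻ a, completionDensity μ ν w (a, b) ∂μ = 1 := by
      filter_upwards [this] with b hb
      simp only [completionDensity, div_eq_mul_inv] at hb ⊢
      simp_rw [mul_left_comm _ (1 - ∫⁻ a, w (a, b) ∂μ)]
      rw [lintegral_add_left (by fun_prop), lintegral_const_mul _ (by fun_prop), hb]
    rw [lintegral_congr_ae (ae_restrict_of_ae h1)]
    simp
  refine ⟨⟨?_⟩, h₁, h₂⟩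
  rw [← preimage_univ (f := (Prod.fst : α × β → α)), ← Measure.map_apply measurable_fst .univ, h₁,
    measure_univ]

lemma lintegral_completion_le (hw : Measurable w) (hu : ∀ a, ∫⁻ b, w (a, b) ∂ν ≤ 1)
    (hv : ∀ b, ∫⁻ a, w (a, b) ∂μ ≤ 1) {c : α × β → ℝ≥0∞} (hc : Measurable c) {D : ℝ≥0∞}
    (hD : ∀ᵐ p ∂(μ.prod ν), c p ≤ D) :
    ∫⁻ p, c p ∂(completion μ ν w) ≤
      ∫⁻ p, c p * w p ∂(μ.prod ν) + D * (1 - ∫⁻ p, w p ∂(μ.prod ν)) := by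
  have hdm := measurable_completionDensity (μ := μ) (ν := ν) hw
  have := (completion_mem_couplings hw hu hv).1
  have hmass : ∫⁻ p, completionDensity μ ν w p ∂(μ.prod ν) = 1 := by
    rw [← setLIntegral_univ, ← withDensity_apply _ .univ]
    exact measure_univ (μ := completion μ ν w)
  have hwfin : ∫⁻ p, w p ∂(μ.prod ν) ≠ ⊤ :=
    ((lintegral_mono fun p => le_self_add).trans_lt (hmass.trans_lt ENNReal.one_lt_top)).ne
  have hle : ∀ p, w p ≤ completionDensity μ ν w p := fun p => le_self_add
  have hrest : ∫⁻ p, (completionDensity μ ν w p - w p) ∂(μ.prod ν) =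
      1 - ∫⁻ p, w p ∂(μ.prod ν) := by
    rw [lintegral_sub hw hwfin (ae_of_all _ hle), hmass]
  have hsplit : ∀ p, completionDensity μ ν w p = w p + (completionDensity μ ν w p - w p) :=
    fun p => (add_tsub_cancel_of_le (hle p)).symm
  rw [completion, lintegral_withDensity_eq_lintegral_mul _ hdm hc, ← hrest,
    ← lintegral_const_mul _ (by fun_prop), ← lintegral_add_left (by fun_prop)]
  refine lintegral_mono_ae ?_
  filter_upwards [hD] with p hp
  calc completionDensity μ ν w p * c p
      = c p * w p + c p * (completionDensity μ ν w p - w p) := by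
        rw [← mul_add, ← hsplit p, mul_comm]
    _ ≤ c p * w p + D * (completionDensity μ ν w p - w p) := by gcongr

end Completion

section Grid

lemma exists_density_of_fintype {ι : Type*} [Fintype ι] [MeasurableSpace ι]
    [MeasurableSingletonClass ι] {μ ν : Measure ι} [IsProbabilityMeasure μ]
    [IsProbabilityMeasure ν] {π : Measure (ι × ι)} (hπ : π ∈ Couplings μ ν) :
    ∃ c : ι → ι → ℝ≥0∞, (∀ i j, c i j ≠ ⊤) ∧ (∀ i, ∫⁻ j, c i j ∂ν ≤ 1) ∧
      (∀ j, ∫⁻ i, c i j ∂μ ≤ 1) ∧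
      ∀ F : ι → ι → ℝ≥0∞, ∫⁻ p, F p.1 p.2 * c p.1 p.2 ∂(μ.prod ν) = ∫⁻ p, F p.1 p.2 ∂π := by
  obtain ⟨hπP, h₁, h₂⟩ := hπ
  have hfst : ∀ i, ∑ j, π {(i, j)} = μ {i} := fun i => by
    have := sum_measure_singleton (μ := π) (s := ({i} : Finset ι) ×ˢ (Finset.univ : Finset ι))
    rw [Finset.sum_product, Finset.sum_singleton] at this
    rw [this, ← h₁, Measure.map_apply measurable_fst (measurableSet_singleton i)]
    congr 1
    ext p
    simp [Prod.ext_iff, eq_comm]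
  have hsnd : ∀ j, ∑ i, π {(i, j)} = ν {j} := fun j => by
    have := sum_measure_singleton (μ := π) (s := (Finset.univ : Finset ι) ×ˢ ({j} : Finset ι))
    rw [Finset.sum_product_right, Finset.sum_singleton] at this
    rw [this, ← h₂, Measure.map_apply measurable_snd (measurableSet_singleton j)]
    congr 1
    ext p
    simp [Prod.ext_iff, eq_comm]
  have hle₁ : ∀ i j, π {(i, j)} ≤ μ {i} := fun i j => by
    rw [← hfst i]
    exact Finset.single_le_sum (f := fun j => π {(i, j)}) (fun _ _ => zero_le) (Finset.mem_univ j)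
  have hle₂ : ∀ i j, π {(i, j)} ≤ ν {j} := fun i j => by
    rw [← hsnd j]
    exact Finset.single_le_sum (f := fun i => π {(i, j)}) (fun _ _ => zero_le) (Finset.mem_univ i)
  have hzero : ∀ i j, μ {i} * ν {j} = 0 → π {(i, j)} = 0 := fun i j h => by
    rcases mul_eq_zero.1 h with h | h
    · exact le_antisymm (h ▸ hle₁ i j) zero_le
    · exact le_antisymm (h ▸ hle₂ i j) zero_le
  have hmul : ∀ i j, π {(i, j)} / (μ {i} * ν {j}) * (μ {i} * ν {j}) = π {(i, j)} := fun i j =>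
    ENNReal.div_mul_cancel' (hzero i j)
      fun h => absurd h (ENNReal.mul_ne_top (measure_ne_top _ _) (measure_ne_top _ _))
  refine ⟨fun i j => π {(i, j)} / (μ {i} * ν {j}), fun i j => ?_, fun i => ?_, fun j => ?_,
    fun F => ?_⟩
  · by_cases h : μ {i} * ν {j} = 0
    · simp [hzero i j h]
    · exact ENNReal.div_ne_top (measure_ne_top _ _) h
  · rw [lintegral_fintype]
    by_cases h : μ {i} = 0
    · have : ∀ j, π {(i, j)} = 0 := fun j => hzero i j (by simp [h])
      simp [this]
    · rw [← ENNReal.mul_le_mul_iff_left h (measure_ne_top _ _), one_mul, Finset.sum_mul]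
      exact ((Finset.sum_congr rfl fun j _ => by
        rw [mul_assoc, mul_comm (ν {j}), hmul]).trans (hfst i)).le
  · rw [lintegral_fintype]
    by_cases h : ν {j} = 0
    · have : ∀ i, π {(i, j)} = 0 := fun i => hzero i j (by simp [h])
      simp [this]
    · rw [← ENNReal.mul_le_mul_iff_left h (measure_ne_top _ _), one_mul, Finset.sum_mul]
      exact ((Finset.sum_congr rfl fun i _ => by rw [mul_assoc, hmul]).trans (hsnd j)).le
  · rw [lintegral_fintype, lintegral_fintype]
    refine Finset.sum_congr rfl fun p _ => ?_
    rw [← singleton_prod_singleton, Measure.prod_prod, mul_assoc, hmul, singleton_prod_singleton]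

variable {α ι : Type*} [MeasurableSpace α] [Fintype ι] [MeasurableSpace ι]
    [MeasurableSingletonClass ι] {q : α → ι} {μ ν : Measure α} [IsProbabilityMeasure μ]
    [IsProbabilityMeasure ν]

lemma exists_grid_density (hq : Measurable q) {π : Measure (α × α)} (hπ : π ∈ Couplings μ ν) :
    ∃ c : ι → ι → ℝ≥0∞, (∀ i j, c i j ≠ ⊤) ∧ (∀ i, ∫⁻ b, c i (q b) ∂ν ≤ 1) ∧
      (∀ j, ∫⁻ a, c (q a) j ∂μ ≤ 1) ∧
      ∀ F : ι → ι → ℝ≥0∞, ∫⁻ p, F (q p.1) (q p.2) * c (q p.1) (q p.2) ∂(μ.prod ν) =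
        ∫⁻ p, F (q p.1) (q p.2) ∂π := by
  have := Measure.isProbabilityMeasure_map (μ := μ) hq.aemeasurable
  have := Measure.isProbabilityMeasure_map (μ := ν) hq.aemeasurable
  have hqq : Measurable (Prod.map q q) := hq.prodMap hq
  have hπ' : π.map (Prod.map q q) ∈ Couplings (μ.map q) (ν.map q) := by
    have := hπ.1
    refine ⟨Measure.isProbabilityMeasure_map hqq.aemeasurable, ?_, ?_⟩
    · rw [Measure.map_map measurable_fst hqq, ← hπ.2.1, Measure.map_map hq measurable_fst]
      rfl
    · rw [Measure.map_map measurable_snd hqq, ← hπ.2.2, Measure.map_map hq measurable_snd]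
      rfl
  obtain ⟨c, hc, hc₁, hc₂, hcF⟩ := exists_density_of_fintype hπ'
  refine ⟨c, hc, fun i => ?_, fun j => ?_, fun F => ?_⟩
  · simpa only [lintegral_map (measurable_of_finite _) hq] using hc₁ i
  · simpa only [lintegral_map (measurable_of_finite fun i => c i j) hq] using hc₂ j
  · have := hcF F
    rw [Measure.map_prod_map _ _ hq hq, lintegral_map (measurable_of_finite _) hqq,
      lintegral_map (measurable_of_finite _) hqq] at this
    exact this

lemma exists_natCast_mul_le {x θ : ℝ≥0∞} (hx : x ≠ ⊤) (hθ : θ ≠ 0) (hθ' : θ ≠ ⊤) :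
    ∃ k : ℕ, k * θ ≤ x ∧ x ≤ k * θ + θ := by
  lift x to NNReal using hx
  lift θ to NNReal using hθ'
  have hθ0 : 0 < θ := pos_iff_ne_zero.2 (by simpa using hθ)
  refine ⟨⌊x / θ⌋₊, ?_, ?_⟩
  · have := (le_div_iff₀ hθ0).1 (Nat.floor_le (zero_le (a := x / θ)))
    exact_mod_cast this
  · have := (div_le_iff₀ hθ0).1 (Nat.lt_floor_add_one (x / θ)).le
    rw [add_mul, one_mul] at this
    exact_mod_cast this

/-- The density which is constant, with value an integer multiple of `θ`, on each cell
`q ⁻¹' {i} × q ⁻¹' {j}`. -/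
def gridDensity (q : α → ι) (θ : ℝ≥0∞) (r : ι → ι → ℕ) (p : α × α) : ℝ≥0∞ :=
  r (q p.1) (q p.2) * θ

omit [Fintype ι] in
lemma measurable_gridDensity [Finite ι] (hq : Measurable q) (θ : ℝ≥0∞) (r : ι → ι → ℕ) :
    Measurable (gridDensity q θ r) :=
  (measurable_of_finite fun p : ι × ι => (r p.1 p.2 : ℝ≥0∞) * θ).comp (hq.prodMap hq)

/-- Any coupling `π` is approximated in cost by the completion of a grid density. -/
lemma exists_gridDensity_lintegral_le (hq : Measurable q) {θ : ℝ≥0∞} (hθ : θ ≠ 0) (hθ' : θ ≠ ⊤)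
    {X : Set α} (hμX : ∀ᵐ a ∂μ, a ∈ X) (hνX : ∀ᵐ a ∂ν, a ∈ X)
    {c : α × α → ℝ≥0∞} (hc : Measurable c) {C : ι → ι → ℝ≥0∞} {D ε : ℝ≥0∞}
    (hcC : ∀ a ∈ X, ∀ b ∈ X, c (a, b) ≤ C (q a) (q b))
    (hCc : ∀ a ∈ X, ∀ b ∈ X, C (q a) (q b) ≤ c (a, b) + ε)
    (hcD : ∀ a ∈ X, ∀ b ∈ X, c (a, b) ≤ D)
    {π : Measure (α × α)} (hπ : π ∈ Couplings μ ν) :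
    ∃ r : ι → ι → ℕ, (∀ i, ∫⁻ b, r i (q b) * θ ∂ν ≤ 1) ∧ (∀ j, ∫⁻ a, r (q a) j * θ ∂μ ≤ 1) ∧
      ∫⁻ p, c p ∂(completion μ ν (gridDensity q θ r)) ≤ ∫⁻ p, c p ∂π + ε + D * θ := by
  obtain ⟨f, hf, hf₁, hf₂, hfF⟩ := exists_grid_density hq hπ
  choose r hr₁ hr₂ using fun i j => exists_natCast_mul_le (hf i j) hθ hθ'
  have hu : ∀ i, ∫⁻ b, r i (q b) * θ ∂ν ≤ 1 :=
    fun i => (lintegral_mono fun b => hr₁ i (q b)).trans (hf₁ i)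
  have hv : ∀ j, ∫⁻ a, r (q a) j * θ ∂μ ≤ 1 :=
    fun j => (lintegral_mono fun a => hr₁ (q a) j).trans (hf₂ j)
  have hw := measurable_gridDensity hq θ r
  have hprod : ∀ᵐ p ∂(μ.prod ν), p.1 ∈ X ∧ p.2 ∈ X :=
    (Measure.quasiMeasurePreserving_fst.ae hμX).and (Measure.quasiMeasurePreserving_snd.ae hνX)
  have hπX : ∀ᵐ p ∂π, p.1 ∈ X ∧ p.2 ∈ X := by
    rw [← hπ.2.1] at hμX
    rw [← hπ.2.2] at hνX
    exact (ae_of_ae_map measurable_fst.aemeasurable hμX).and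
      (ae_of_ae_map measurable_snd.aemeasurable hνX)
  have hmass : 1 - ∫⁻ p, gridDensity q θ r p ∂(μ.prod ν) ≤ θ := by
    have := hπ.1
    rw [tsub_le_iff_left]
    calc (1 : ℝ≥0∞) = ∫⁻ p, f (q p.1) (q p.2) ∂(μ.prod ν) := by
          have := hfF fun _ _ => 1
          simpa using this.symm
      _ ≤ ∫⁻ p, (gridDensity q θ r p + θ) ∂(μ.prod ν) := lintegral_mono fun p => hr₂ _ _
      _ = ∫⁻ p, gridDensity q θ r p ∂(μ.prod ν) + θ := by
          rw [lintegral_add_left hw]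
          simp
  refine ⟨r, hu, hv, ?_⟩
  refine (lintegral_completion_le hw (fun a => hu (q a)) (fun b => hv (q b)) hc
    (hprod.mono fun p hp => hcD _ hp.1 _ hp.2)).trans (add_le_add ?_ (by gcongr))
  calc ∫⁻ p, c p * gridDensity q θ r p ∂(μ.prod ν)
      ≤ ∫⁻ p, C (q p.1) (q p.2) * f (q p.1) (q p.2) ∂(μ.prod ν) :=
        lintegral_mono_ae (hprod.mono fun p hp => mul_le_mul' (hcC _ hp.1 _ hp.2) (hr₁ _ _))
    _ = ∫⁻ p, C (q p.1) (q p.2) ∂π := hfF C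
    _ ≤ ∫⁻ p, (c p + ε) ∂π := lintegral_mono_ae (hπX.mono fun p hp => hCc _ hp.1 _ hp.2)
    _ = ∫⁻ p, c p ∂π + ε := by
      have := hπ.1
      rw [lintegral_add_left hc]
      simp

end Grid

section Selection

variable {α Ω : Type*} [MeasurableSpace Ω]

lemma exists_measurable_forall_lintegral_le [MeasurableSpace α] {ι : Type*} [Nonempty ι]
    [Countable ι] {P : ι → Ω → Measure α} (hP : ∀ i, Measurable (P i)) {c : α → ℝ≥0∞}
    (hc : Measurable c) {ε : ℝ≥0∞} (hε : ε ≠ 0) :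
    ∃ Q : Ω → Measure α, Measurable Q ∧ (∀ y, ∃ i, Q y = P i y) ∧
      ∀ y i, ∫⁻ x, c x ∂(Q y) ≤ ∫⁻ x, c x ∂(P i y) + ε := by
  classical
  obtain ⟨e, he⟩ := exists_surjective_nat ι
  have hm : ∀ i, Measurable fun y => ∫⁻ x, c x ∂(P i y) :=
    fun i => (Measure.measurable_lintegral hc).comp (hP i)
  have hex : ∀ y, ∃ n, ∫⁻ x, c x ∂(P (e n) y) ≤ (⨅ i, ∫⁻ x, c x ∂(P i y)) + ε := fun y => by
    by_cases h : (⨅ i, ∫⁻ x, c x ∂(P i y)) = ⊤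
    · exact ⟨0, by simp [h]⟩
    · obtain ⟨i, hi⟩ := iInf_lt_iff.1 (ENNReal.lt_add_right h hε)
      obtain ⟨n, rfl⟩ := he i
      exact ⟨n, hi.le⟩
  refine ⟨fun y => P (e (Nat.find (hex y))) y, ?_, fun y => ⟨_, rfl⟩, fun y i => ?_⟩
  · exact Measurable.find (f := fun n y => P (e n) y) (fun n => hP (e n))
      (fun n => measurableSet_le (hm _) ((Measurable.iInf hm).add_const ε)) hex
  · refine (Nat.find_spec (hex y)).trans ?_
    gcongr
    exact iInf_le _ i

variable [MetricSpace α] [MeasurableSpace α] [BorelSpace α] [SecondCountableTopology α]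

/-- A compact set is partitioned by a measurable map into finitely many small cells. -/
lemma IsCompact.exists_measurable_edist_le [Nonempty α] {X : Set α} (hX : IsCompact X) {δ : ℝ≥0∞}
    (hδ : δ ≠ 0) :
    ∃ (N : ℕ) (q : α → Fin (N + 1)) (s : Fin (N + 1) → α), Measurable q ∧
      ∀ x ∈ X, edist x (s (q x)) ≤ δ := by
  let e := TopologicalSpace.denseSeq α
  obtain ⟨t, ht⟩ := hX.elim_finite_subcover (fun n => Metric.eball (e n) δ)
    (fun n => Metric.isOpen_eball) fun x _ => by
      obtain ⟨_, ⟨n, rfl⟩, hy⟩ := EMetric.mem_closure_iff.1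
        ((TopologicalSpace.denseRange_denseSeq α) x) δ (pos_iff_ne_zero.2 hδ)
      exact mem_iUnion.2 ⟨n, hy⟩
  let N := t.sup id
  refine ⟨N, fun x => ⟨SimpleFunc.nearestPtInd e N x,
    Nat.lt_succ_of_le (SimpleFunc.nearestPtInd_le e N x)⟩, fun i => e i, ?_, fun x hx => ?_⟩
  · refine measurable_to_countable' fun i => ?_
    have h := (SimpleFunc.nearestPtInd e N).measurableSet_fiber (i : ℕ)
    convert h using 1
    ext x
    simp [Fin.ext_iff]
  · obtain ⟨n, hn, hxn⟩ := mem_iUnion₂.1 (ht hx)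
    have h := SimpleFunc.edist_nearestPt_le e x (Finset.le_sup (f := id) hn : n ≤ N)
    rw [edist_comm]
    exact h.trans (by rw [edist_comm]; exact hxn.le)

lemma exists_sq_add_le {D ε : ℝ≥0∞} (hD : D ≠ ⊤) (hε : ε ≠ 0) :
    ∃ δ : ℝ≥0∞, δ ≠ 0 ∧ ∀ a ≤ D, (a + δ) ^ 2 ≤ a ^ 2 + ε := by
  have ht : Tendsto (fun δ : ℝ≥0∞ => δ * (2 * D + δ)) (𝓝[>] 0) (𝓝 (0 * (2 * D + 0))) := by
    refine ENNReal.Tendsto.mul ?_ ?_ ?_ ?_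
    · exact tendsto_nhdsWithin_of_tendsto_nhds tendsto_id
    · right; simp [ENNReal.mul_ne_top, hD]
    · exact tendsto_nhdsWithin_of_tendsto_nhds (tendsto_const_nhds.add tendsto_id)
    · right; simp
  rw [zero_mul] at ht
  obtain ⟨δ, hδ, h0⟩ := ((ht.eventually (gt_mem_nhds (pos_iff_ne_zero.2 hε))).and
    self_mem_nhdsWithin).exists
  refine ⟨δ, (ne_of_gt h0), fun a ha => ?_⟩
  calc (a + δ) ^ 2 = a ^ 2 + δ * (2 * a + δ) := by ring
    _ ≤ a ^ 2 + δ * (2 * D + δ) := by gcongr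
    _ ≤ a ^ 2 + ε := by gcongr

/-- Measurable selection of almost optimal plans between two measurable families of measures
concentrated on a compact set. -/
lemma exists_kernel_couplings_lintegral_le [Nonempty α] {X : Set α} (hX : IsCompact X)
    (K L : Kernel Ω α) [IsMarkovKernel K] [IsMarkovKernel L] {ε : ℝ≥0∞} (hε : ε ≠ 0) :
    ∃ Q : Kernel Ω (α × α), (∀ y, Q y ∈ Couplings (K y) (L y)) ∧
      ∀ y, (∀ᵐ a ∂(K y), a ∈ X) → (∀ᵐ a ∂(L y), a ∈ X) →
        ∫⁻ p, edist p.1 p.2 ^ 2 ∂(Q y) ≤ W2sq (K y) (L y) + ε := by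
  classical
  wlog hε' : ε ≠ ⊤ generalizing ε
  · obtain ⟨Q, hQ, hQ'⟩ := this one_ne_zero ENNReal.one_ne_top
    exact ⟨Q, hQ, fun y h₁ h₂ => (hQ' y h₁ h₂).trans (by gcongr; simp [not_not.1 hε'])⟩
  have hε3 : ε / 3 ≠ 0 := by simp [hε]
  have hD : Metric.ediam X ≠ ⊤ := hX.isBounded.ediam_ne_top
  obtain ⟨δ, hδ, hδε⟩ := exists_sq_add_le hD hε3
  have hδ4 : δ / 2 / 2 ≠ 0 := by simp [hδ]
  obtain ⟨N, q, s, hq, hs⟩ := hX.exists_measurable_edist_le hδ4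
  obtain ⟨θ, hθ0, hθ⟩ : ∃ θ : ℝ≥0∞, (θ ≠ 0 ∧ θ ≠ ⊤) ∧ Metric.ediam X ^ 2 * θ ≤ ε / 3 := by
    obtain ⟨θ, hθ0, hθ⟩ := ENNReal.exists_nnreal_pos_mul_lt (ENNReal.pow_ne_top (n := 2) hD) hε3
    exact ⟨θ, ⟨by simpa using hθ0.ne', ENNReal.coe_ne_top⟩, by rw [mul_comm]; exact hθ.le⟩
  let F : (Fin (N + 1) → Fin (N + 1) → ℕ) → Set Ω := fun r =>
    {y | (∀ i, ∫⁻ b, r i (q b) * θ ∂(L y) ≤ 1) ∧ ∀ j, ∫⁻ a, r (q a) j * θ ∂(K y) ≤ 1}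
  have hF : ∀ r, MeasurableSet (F r) := fun r => by
    have hFr : F r = (⋂ i, {y | ∫⁻ b, r i (q b) * θ ∂(L y) ≤ 1}) ∩
        ⋂ j, {y | ∫⁻ a, r (q a) j * θ ∂(K y) ≤ 1} := by
      ext y
      simp [F]
    rw [hFr]
    refine (MeasurableSet.iInter fun i => measurableSet_le ?_ measurable_const).inter
      (MeasurableSet.iInter fun j => measurableSet_le ?_ measurable_const)
    · exact Measurable.lintegral_kernel
        ((measurable_of_finite fun j => (r i j : ℝ≥0∞) * θ).comp hq)
    · exact Measurable.lintegral_kernel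
        ((measurable_of_finite fun i => (r i j : ℝ≥0∞) * θ).comp hq)
  let P : (Fin (N + 1) → Fin (N + 1) → ℕ) → Ω → Measure (α × α) := fun r y =>
    if y ∈ F r then completion (K y) (L y) (gridDensity q θ r) else (K ×ₖ L) y
  have hPm : ∀ r, Measurable (P r) := fun r =>
    Measurable.ite (hF r) (measurable_completion_kernel K L (measurable_gridDensity hq θ r))
      (Kernel.measurable _)
  have hPc : ∀ r y, P r y ∈ Couplings (K y) (L y) := fun r y => by
    by_cases h : y ∈ F r
    · simp only [P, if_pos h]
      exact completion_mem_couplings (measurable_gridDensity hq θ r) (fun a => h.1 (q a))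
        fun b => h.2 (q b)
    · simp only [P, if_neg h, Kernel.prod_apply]
      exact ⟨inferInstance, by simp, by simp⟩
  have hcm : Measurable fun p : α × α => edist p.1 p.2 ^ 2 := measurable_edist.pow_const 2
  obtain ⟨Q, hQm, hQP, hQ⟩ := exists_measurable_forall_lintegral_le hPm hcm hε3
  refine ⟨⟨Q, hQm⟩, fun y => ?_, fun y hK hL => ?_⟩
  · obtain ⟨r, hr⟩ := hQP y
    change Q y ∈ _
    rw [hr]
    exact hPc r y
  · have hcell : ∀ a ∈ X, ∀ b ∈ X,
        edist a b ≤ edist (s (q a)) (s (q b)) + δ / 2 ∧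
          edist (s (q a)) (s (q b)) + δ / 2 ≤ edist a b + δ := fun a ha b hb => by
      have h₁ := hs a ha
      have h₂ := hs b hb
      have h4 : δ / 2 / 2 + δ / 2 / 2 = δ / 2 := ENNReal.add_halves _
      constructor
      · calc edist a b ≤ edist a (s (q a)) + edist (s (q a)) (s (q b)) + edist (s (q b)) b :=
              edist_triangle4 _ _ _ _
          _ ≤ δ / 2 / 2 + edist (s (q a)) (s (q b)) + δ / 2 / 2 := by
              rw [edist_comm _ b]
              gcongr
          _ = edist (s (q a)) (s (q b)) + δ / 2 := by
              rw [add_comm (δ / 2 / 2), add_assoc, h4]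
      · calc edist (s (q a)) (s (q b)) + δ / 2
            ≤ edist (s (q a)) a + edist a b + edist b (s (q b)) + δ / 2 := by
              gcongr
              exact edist_triangle4 _ _ _ _
          _ ≤ δ / 2 / 2 + edist a b + δ / 2 / 2 + δ / 2 := by
              rw [edist_comm _ a]
              gcongr
          _ = edist a b + (δ / 2 / 2 + δ / 2 / 2 + δ / 2) := by ring
          _ = edist a b + δ := by rw [h4, ENNReal.add_halves]
    have hε3' : ε / 3 + ε / 3 + ε / 3 = ε := ENNReal.add_thirds ε
    rw [W2sq, transportCost, ENNReal.iInf_add]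
    refine le_iInf fun π => ?_
    rw [ENNReal.iInf_add]
    refine le_iInf fun hπ => ?_
    obtain ⟨r, hr₁, hr₂, hr⟩ := exists_gridDensity_lintegral_le hq hθ0.1 hθ0.2 hK hL hcm
      (C := fun i j => (edist (s i) (s j) + δ / 2) ^ 2) (D := Metric.ediam X ^ 2) (ε := ε / 3)
      (fun a ha b hb => by gcongr; exact (hcell a ha b hb).1)
      (fun a ha b hb => (pow_le_pow_left' (hcell a ha b hb).2 2).trans
        (hδε _ (Metric.edist_le_ediam_of_mem ha hb)))
      (fun a ha b hb => pow_le_pow_left' (Metric.edist_le_ediam_of_mem ha hb) 2) hπ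
    have hy : y ∈ F r := ⟨hr₁, hr₂⟩
    have hQr := hQ y r
    simp only [P, if_pos hy] at hQr
    calc ∫⁻ p, edist p.1 p.2 ^ 2 ∂(Q y)
        ≤ ∫⁻ p, edist p.1 p.2 ^ 2 ∂π + ε / 3 + Metric.ediam X ^ 2 * θ + ε / 3 :=
          hQr.trans (by gcongr)
      _ ≤ ∫⁻ p, edist p.1 p.2 ^ 2 ∂π + ε / 3 + ε / 3 + ε / 3 := by gcongr
      _ = ∫⁻ p, edist p.1 p.2 ^ 2 ∂π + ε := by rw [add_assoc, add_assoc, ← add_assoc (ε / 3), hε3']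

end Selection

section Disintegration

variable {α Ω : Type*} [MeasurableSpace α] [MeasurableSpace Ω] {ν : Measure Ω}
  [IsProbabilityMeasure ν]

omit [IsProbabilityMeasure ν] in
lemma IsDisint.measure_eq {ρ ρ' : Measure (α × Ω)} [IsFiniteMeasure ρ] {K : Kernel Ω α}
    (h : IsDisint ν ρ K) (h' : IsDisint ν ρ' K) : ρ = ρ' :=
  Measure.ext_prod fun {s t} hs ht => by rw [h.2 s t hs ht, h'.2 s t hs ht]

lemma isDisint_map_compProd (Q : Kernel Ω (α × α)) [IsMarkovKernel Q] {f : α × α → α}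
    (hf : Measurable f) : IsDisint ν ((ν ⊗ₘ Q).map fun p => (f p.2, p.1)) (Q.map f) := by
  refine ⟨Kernel.IsMarkovKernel.map _ hf, fun s t hs ht => ?_⟩
  rw [Measure.map_apply (by fun_prop) (hs.prod ht)]
  have : (fun p : Ω × (α × α) => (f p.2, p.1)) ⁻¹' s ×ˢ t = t ×ˢ (f ⁻¹' s) := by
    ext p
    simp [and_comm]
  rw [this, Measure.compProd_apply_prod ht (hf hs)]
  simp_rw [Kernel.map_apply' _ hf _ hs]

omit [IsProbabilityMeasure ν] in
lemma IsDisint.ae_ae_mem {ρ : Measure (α × Ω)} {K : Kernel Ω α} (h : IsDisint ν ρ K)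
    {X : Set α} (hX : MeasurableSet X) (hρX : ρ.map Prod.fst Xᶜ = 0) :
    ∀ᵐ y ∂ν, ∀ᵐ a ∂(K y), a ∈ X := by
  rw [Measure.map_apply measurable_fst hX.compl, ← prod_univ, h.2 _ _ hX.compl .univ,
    Measure.restrict_univ, lintegral_eq_zero_iff (K.measurable_coe hX.compl)] at hρX
  exact hρX

end Disintegration

section Fibered

variable {α Ω : Type*} [MeasurableSpace Ω] [MetricSpace α] [MeasurableSpace α] [BorelSpace α]
  [SecondCountableTopology α] [Nonempty α] {ν : Measure Ω} [IsProbabilityMeasure ν]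

lemma WFsq_map_le_lintegral [CompleteSpace α] {γ : Measure (α × α × Ω)} [IsProbabilityMeasure γ]
    (hγ : γ.map (fun p => p.2.2) = ν) :
    WFsq ν (γ.map fun p => (p.1, p.2.2)) (γ.map fun p => p.2) ≤
      ∫⁻ p, edist p.1 p.2.1 ^ 2 ∂γ := by
  have hm : Measurable fun p : α × α × Ω => (p.2.2, (p.1, p.2.1)) := by fun_prop
  set γ' : Measure (Ω × (α × α)) := γ.map fun p => (p.2.2, (p.1, p.2.1)) with hγ'
  have : IsProbabilityMeasure γ' := Measure.isProbabilityMeasure_map hm.aemeasurable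
  have hfst : γ'.fst = ν := by
    rw [Measure.fst, hγ', Measure.map_map measurable_fst hm]
    exact hγ
  have hdis : ν ⊗ₘ γ'.condKernel = γ' := by
    rw [← hfst]
    exact γ'.disintegrate γ'.condKernel
  have hmap₁ : γ'.map (fun p => (p.2.1, p.1)) = γ.map fun p => (p.1, p.2.2) := by
    rw [hγ', Measure.map_map (by fun_prop) hm]
    rfl
  have hmap₂ : γ'.map (fun p => (p.2.2, p.1)) = γ.map fun p => p.2 := by
    rw [hγ', Measure.map_map (by fun_prop) hm]
    rfl
  have h₁ := isDisint_map_compProd (ν := ν) γ'.condKernel measurable_fst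
  have h₂ := isDisint_map_compProd (ν := ν) γ'.condKernel measurable_snd
  rw [hdis, hmap₁] at h₁
  rw [hdis, hmap₂] at h₂
  refine iInf₂_le_of_le (γ'.condKernel.map Prod.fst) (γ'.condKernel.map Prod.snd) ?_
  refine iInf₂_le_of_le h₁ h₂ ?_
  have hcm : Measurable fun p : α × α => edist p.1 p.2 ^ 2 := measurable_edist.pow_const 2
  calc ∫⁻ y, W2sq (γ'.condKernel.map Prod.fst y) (γ'.condKernel.map Prod.snd y) ∂ν
      ≤ ∫⁻ y, ∫⁻ p, edist p.1 p.2 ^ 2 ∂(γ'.condKernel y) ∂ν := lintegral_mono fun y =>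
        iInf₂_le _ ⟨inferInstance, (Kernel.map_apply _ measurable_fst y).symm,
          (Kernel.map_apply _ measurable_snd y).symm⟩
    _ = ∫⁻ p, edist p.2.1 p.2.2 ^ 2 ∂(ν ⊗ₘ γ'.condKernel) :=
        (Measure.lintegral_compProd (f := fun p : Ω × (α × α) => edist p.2.1 p.2.2 ^ 2)
          (hcm.comp measurable_snd)).symm
    _ = ∫⁻ p, edist p.1 p.2.1 ^ 2 ∂γ := by
        rw [hdis, hγ']
        exact lintegral_map (hcm.comp measurable_snd) hm

lemma exists_lintegral_le_WFsq_add {X : Set α} (hX : IsCompact X) {ρ₁ ρ₂ : Measure (α × Ω)}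
    [IsProbabilityMeasure ρ₁] [IsProbabilityMeasure ρ₂] (h₁ : ρ₁.map Prod.fst Xᶜ = 0)
    (h₂ : ρ₂.map Prod.fst Xᶜ = 0) (hW : WFsq ν ρ₁ ρ₂ ≠ ⊤) {ε : ℝ≥0∞} (hε : ε ≠ 0) :
    ∃ γ : Measure (α × α × Ω), γ.map (fun p => (p.1, p.2.2)) = ρ₁ ∧ γ.map (fun p => p.2) = ρ₂ ∧
      ∫⁻ p, edist p.1 p.2.1 ^ 2 ∂γ ≤ WFsq ν ρ₁ ρ₂ + ε := by
  have hε2 : ε / 2 ≠ 0 := by simp [hε]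
  obtain ⟨K, hK⟩ := iInf_lt_iff.1 (ENNReal.lt_add_right hW hε2)
  obtain ⟨L, hL⟩ := iInf_lt_iff.1 hK
  obtain ⟨hρ₁, hL⟩ := iInf_lt_iff.1 hL
  obtain ⟨hρ₂, hKL⟩ := iInf_lt_iff.1 hL
  have := hρ₁.1
  have := hρ₂.1
  obtain ⟨Q, hQ, hQ'⟩ := exists_kernel_couplings_lintegral_le hX K L hε2
  have : IsMarkovKernel Q := ⟨fun y => (hQ y).1⟩
  have hQK : Q.map Prod.fst = K := by
    ext1 y
    rw [Kernel.map_apply _ measurable_fst, (hQ y).2.1]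
  have hQL : Q.map Prod.snd = L := by
    ext1 y
    rw [Kernel.map_apply _ measurable_snd, (hQ y).2.2]
  have hm : Measurable fun p : Ω × (α × α) => (p.2.1, p.2.2, p.1) := by fun_prop
  have hcm : Measurable fun p : α × α => edist p.1 p.2 ^ 2 := measurable_edist.pow_const 2
  refine ⟨(ν ⊗ₘ Q).map fun p => (p.2.1, p.2.2, p.1), ?_, ?_, ?_⟩
  · rw [Measure.map_map (by fun_prop) hm]
    exact (hρ₁.measure_eq (hQK ▸ isDisint_map_compProd Q measurable_fst)).symm
  · rw [Measure.map_map (by fun_prop) hm]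
    exact (hρ₂.measure_eq (hQL ▸ isDisint_map_compProd Q measurable_snd)).symm
  · calc ∫⁻ p, edist p.1 p.2.1 ^ 2 ∂((ν ⊗ₘ Q).map fun p => (p.2.1, p.2.2, p.1))
        = ∫⁻ p, edist p.2.1 p.2.2 ^ 2 ∂(ν ⊗ₘ Q) :=
          lintegral_map (f := fun p : α × α × Ω => edist p.1 p.2.1 ^ 2)
            (hcm.comp (by fun_prop : Measurable fun p : α × α × Ω => (p.1, p.2.1))) hm
      _ = ∫⁻ y, ∫⁻ p, edist p.1 p.2 ^ 2 ∂(Q y) ∂ν :=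
          Measure.lintegral_compProd (f := fun p : Ω × (α × α) => edist p.2.1 p.2.2 ^ 2)
            (hcm.comp measurable_snd)
      _ ≤ ∫⁻ y, (W2sq (K y) (L y) + ε / 2) ∂ν := by
          refine lintegral_mono_ae ?_
          filter_upwards [hρ₁.ae_ae_mem hX.measurableSet h₁, hρ₂.ae_ae_mem hX.measurableSet h₂]
            with y hy₁ hy₂ using hQ' y hy₁ hy₂
      _ = ∫⁻ y, W2sq (K y) (L y) ∂ν + ε / 2 := by
          rw [lintegral_add_right _ measurable_const]
          simp
      _ ≤ WFsq ν ρ₁ ρ₂ + ε / 2 + ε / 2 := by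
          gcongr
          exact hKL.le
      _ = WFsq ν ρ₁ ρ₂ + ε := by rw [add_assoc, ENNReal.add_halves]

end Fibered

section Primal

variable {d d' : ℕ} {X : Set (Euc d)} {ν : Measure (Euc d')} {V : Euc d × Euc d' → ℝ} {κ τ : ℝ}
  {μ : Measure (Euc d)} {ρbar : Measure (Euc d × Euc d')}

lemma primalFun_eq {γ : Measure (Euc d × Euc d × Euc d')}
    (hV : AEMeasurable (fun p => ENNReal.ofReal (V p)) (γ.map fun p => (p.1, p.2.2))) :
    PrimalFun X ν V κ τ γ = ENNReal.ofReal (1 / (2 * τ)) * (∫⁻ p, edist p.1 p.2.1 ^ 2 ∂γ)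
      + (∫⁻ p, ENNReal.ofReal (V p) ∂(γ.map fun p => (p.1, p.2.2)))
      + ENNReal.ofReal κ * entropyH (Lref X ν) (γ.map fun p => (p.1, p.2.2)) := by
  have hcm : Measurable fun p : Euc d × Euc d × Euc d' => edist p.1 p.2.1 ^ 2 :=
    (measurable_fst.edist measurable_snd.fst).pow_const 2
  rw [PrimalFun, lintegral_add_left (hcm.const_mul _), lintegral_const_mul _ hcm,
    lintegral_map' hV (by fun_prop)]

lemma map_mem_couplings [IsProbabilityMeasure μ] (hρbar : ρbar ∈ Couplings μ ν)
    {γ : Measure (Euc d × Euc d × Euc d')} (hγ : γ ∈ PrimalFeas μ ρbar) :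
    γ.map (fun p => (p.1, p.2.2)) ∈ Couplings μ ν := by
  have hm : Measurable fun p : Euc d × Euc d × Euc d' => (p.1, p.2.2) := by fun_prop
  have : IsProbabilityMeasure (γ.map fun p => p.1) := by rw [hγ.1]; infer_instance
  have := Measure.isProbabilityMeasure_of_map (μ := γ) fun p => p.1
  refine ⟨Measure.isProbabilityMeasure_map hm.aemeasurable, ?_, ?_⟩
  · rw [Measure.map_map measurable_fst hm, ← hγ.1]
    rfl
  · rw [Measure.map_map measurable_snd hm, ← hρbar.2.2, ← hγ.2,
      Measure.map_map measurable_snd measurable_snd]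
    rfl

lemma jkoFun_map_le_primalFun [IsProbabilityMeasure μ] [IsProbabilityMeasure ν]
    (hρbar : ρbar ∈ Couplings μ ν)
    (hV : ∀ ρ ∈ Couplings μ ν, AEMeasurable (fun p => ENNReal.ofReal (V p)) ρ)
    {γ : Measure (Euc d × Euc d × Euc d')} (hγ : γ ∈ PrimalFeas μ ρbar) :
    JKOFun X ν V κ τ ρbar (γ.map fun p => (p.1, p.2.2)) ≤ PrimalFun X ν V κ τ γ := by
  have hρ := map_mem_couplings hρbar hγ
  have := hρ.1
  have : IsProbabilityMeasure γ :=
    Measure.isProbabilityMeasure_of_map (μ := γ) fun p => (p.1, p.2.2)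
  rw [primalFun_eq (hV _ hρ), JKOFun]
  gcongr
  have hγν : γ.map (fun p => p.2.2) = ν := by
    rw [← hρ.2.2, Measure.map_map measurable_snd (by fun_prop)]
    rfl
  have := WFsq_map_le_lintegral hγν
  rwa [hγ.2] at this

lemma iInf_primalFun_le_jkoFun [IsProbabilityMeasure μ] [IsProbabilityMeasure ν]
    (hX : IsCompact X) (hτ : 0 < τ) (hμX : μ Xᶜ = 0) (hρbar : ρbar ∈ Couplings μ ν)
    (hV : ∀ ρ ∈ Couplings μ ν, AEMeasurable (fun p => ENNReal.ofReal (V p)) ρ)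
    {ρ : Measure (Euc d × Euc d')} (hρ : ρ ∈ Couplings μ ν) :
    ⨅ γ ∈ PrimalFeas μ ρbar, PrimalFun X ν V κ τ γ ≤ JKOFun X ν V κ τ ρbar ρ := by
  have := hρ.1
  have := hρbar.1
  have hτ' : ENNReal.ofReal (1 / (2 * τ)) ≠ 0 := by
    rw [ne_eq, ENNReal.ofReal_eq_zero, not_le]
    positivity
  by_cases hW : WFsq ν ρ ρbar = ⊤
  · rw [JKOFun, hW, ENNReal.mul_top hτ', top_add, top_add]
    exact le_top
  refine ENNReal.le_of_forall_pos_le_add fun ε hε _ => ?_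
  obtain ⟨γ, hγ₁, hγ₂, hγ⟩ := exists_lintegral_le_WFsq_add hX (hρ.2.1 ▸ hμX) (hρbar.2.1 ▸ hμX) hW
    (ENNReal.div_ne_zero.2 ⟨ENNReal.coe_ne_zero.2 hε.ne', ENNReal.ofReal_ne_top⟩ :
      ε / ENNReal.ofReal (1 / (2 * τ)) ≠ 0)
  have hfeas : γ ∈ PrimalFeas μ ρbar := by
    refine ⟨?_, hγ₂⟩
    rw [← hρ.2.1, ← hγ₁, Measure.map_map measurable_fst (by fun_prop)]
    rfl
  refine (iInf₂_le γ hfeas).trans ?_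
  rw [primalFun_eq (hγ₁ ▸ hV ρ hρ), hγ₁, JKOFun]
  calc _ ≤ ENNReal.ofReal (1 / (2 * τ)) * (WFsq ν ρ ρbar + ε / ENNReal.ofReal (1 / (2 * τ)))
        + (∫⁻ p, ENNReal.ofReal (V p) ∂ρ) + ENNReal.ofReal κ * entropyH (Lref X ν) ρ := by gcongr
    _ = _ := by
      rw [mul_add, ENNReal.mul_div_cancel hτ' ENNReal.ofReal_ne_top]
      ring

end Primal

/-- the minimizing movement problem `inf_{ρ ∈ Γ(μ,ν)} E_τ(ρ|ρ̄)` has the same value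
as the convex three-variable primal problem, and any minimizer `γ` of the latter projects via
`P₁₃` to a minimizer of `E_τ(·|ρ̄)` over `Γ(μ,ν)`. -/
theorem stmt9 {d d' : ℕ} (X : Set (Euc d)) (Y : Set (Euc d'))
    (hX : IsCompact X) (hXne : X.Nonempty) (hY : IsCompact Y) (hYne : Y.Nonempty)
    (V : Euc d × Euc d' → ℝ) (hV : ContinuousOn V (X ×ˢ Y)) (hV0 : ∀ p, 0 ≤ V p)
    (κ : ℝ) (hκ : 0 < κ) (τ : ℝ) (hτ : 0 < τ)
    (ν : Measure (Euc d')) [IsProbabilityMeasure ν] (hνY : ν Yᶜ = 0)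
    (μ : Measure (Euc d)) [IsProbabilityMeasure μ]
    (hμac : μ ≪ volume.restrict X)
    (ρbar : Measure (Euc d × Euc d')) (hρbar : ρbar ∈ Couplings μ ν)
    (hρbarXY : ρbar ((X ×ˢ Y)ᶜ) = 0) :
    (⨅ ρ ∈ Couplings μ ν, JKOFun X ν V κ τ ρbar ρ)
        = (⨅ γ ∈ PrimalFeas μ ρbar, PrimalFun X ν V κ τ γ)
      ∧ ∀ γ ∈ PrimalFeas μ ρbar,
          (∀ γ' ∈ PrimalFeas μ ρbar, PrimalFun X ν V κ τ γ ≤ PrimalFun X ν V κ τ γ') →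
          γ.map (fun p => (p.1, p.2.2)) ∈ Couplings μ ν ∧
            ∀ ρ ∈ Couplings μ ν,
              JKOFun X ν V κ τ ρbar (γ.map (fun p => (p.1, p.2.2)))
                ≤ JKOFun X ν V κ τ ρbar ρ := by
  have hμX : μ Xᶜ = 0 := hμac (by
    rw [Measure.restrict_apply hX.measurableSet.compl, compl_inter_self, measure_empty])
  have hVm : ∀ ρ ∈ Couplings μ ν, AEMeasurable (fun p => ENNReal.ofReal (V p)) ρ := by
    intro ρ hρ
    have h₁ : ∀ᵐ p ∂ρ, p.1 ∈ X :=
      ae_of_ae_map measurable_fst.aemeasurable (hρ.2.1 ▸ (hμX : ∀ᵐ x ∂μ, x ∈ X))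
    have h₂ : ∀ᵐ p ∂ρ, p.2 ∈ Y :=
      ae_of_ae_map measurable_snd.aemeasurable (hρ.2.2 ▸ (hνY : ∀ᵐ y ∂ν, y ∈ Y))
    have h := hV.aemeasurable (μ := ρ) (hX.measurableSet.prod hY.measurableSet)
    have h₃ : ∀ᵐ p ∂ρ, p ∈ X ×ˢ Y := h₁.and h₂
    rw [Measure.restrict_eq_self_of_ae_mem h₃] at h
    exact h.ennreal_ofReal
  have hle := fun ρ hρ =>
    iInf_primalFun_le_jkoFun (κ := κ) hX hτ hμX hρbar hVm (ρ := ρ) hρ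
  refine ⟨le_antisymm ?_ (le_iInf₂ hle), fun γ hγ hmin =>
    ⟨map_mem_couplings hρbar hγ, fun ρ hρ => ?_⟩⟩
  · exact le_iInf₂ fun γ hγ => (iInf₂_le _ (map_mem_couplings hρbar hγ)).trans
      (jkoFun_map_le_primalFun hρbar hVm hγ)
  · exact (jkoFun_map_le_primalFun hρbar hVm hγ).trans ((le_iInf₂ hmin).trans (hle ρ hρ))

end
end

section
/- Let V ∈ C²(X×Y) be nonnegative, κ > 0, τ > 0, ν a probability measure on Y, and μ a probability measure on X with Lebesgue density bounded above and bounded away from zero. Then for every ρ̄ ∈ Γ(μ,ν), the functional E_τ(ρ|ρ̄) := (1/2τ) W_F(ρ,ρ̄)² + ∫ V dρ + κ H(ρ|ν) admits a unique minimizer over Γ(μ,ν). -/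
open MeasureTheory ProbabilityTheory Filter Set
open scoped ENNReal Topology

noncomputable section

section Transport

variable {α β : Type*} [MeasurableSpace α] [MeasurableSpace β]

/-- A sub-coupling can be completed to a coupling, at a cost controlled by the missing mass. -/
lemma transportCost_le_of_subcoupling {c : α → β → ℝ≥0∞} {B : ℝ≥0∞} (hcB : ∀ a b, c a b ≤ B)
    {k₁ : Measure α} {k₂ : Measure β} [IsProbabilityMeasure k₁] [IsProbabilityMeasure k₂]
    {γ : Measure (α × β)} (h₁ : γ.map Prod.fst ≤ k₁) (h₂ : γ.map Prod.snd ≤ k₂) :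
    transportCost c k₁ k₂ ≤ (∫⁻ p, c p.1 p.2 ∂γ) + B * (1 - γ univ) := by
  have hu₁ : (γ.map Prod.fst) univ = γ univ := by
    rw [Measure.map_apply measurable_fst MeasurableSet.univ, preimage_univ]
  have hu₂ : (γ.map Prod.snd) univ = γ univ := by
    rw [Measure.map_apply measurable_snd MeasurableSet.univ, preimage_univ]
  have hγ1 : γ univ ≤ 1 := by
    rw [← hu₁, ← measure_univ (μ := k₁)]; exact h₁ univ
  have hfin : IsFiniteMeasure γ := ⟨hγ1.trans_lt ENNReal.one_lt_top⟩
  set r := 1 - γ univ with hr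
  have hr1 : r ≤ 1 := tsub_le_self
  have hrtop : r ≠ ⊤ := ne_top_of_le_ne_top ENNReal.one_ne_top hr1
  set s₁ := k₁ - γ.map Prod.fst with hs₁
  set s₂ := k₂ - γ.map Prod.snd with hs₂
  have hs₁u : s₁ univ = r := by
    rw [hs₁, Measure.sub_apply MeasurableSet.univ h₁, hu₁, measure_univ]
  have hs₂u : s₂ univ = r := by
    rw [hs₂, Measure.sub_apply MeasurableSet.univ h₂, hu₂, measure_univ]
  have : IsFiniteMeasure s₁ := ⟨by rw [hs₁u]; exact hrtop.lt_top⟩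
  have : IsFiniteMeasure s₂ := ⟨by rw [hs₂u]; exact hrtop.lt_top⟩
  set ρ := r⁻¹ • s₁.prod s₂ with hρ
  have hR₁ : ρ.map Prod.fst = s₁ := by
    rw [hρ, Measure.map_smul, Measure.map_fst_prod, hs₂u, smul_smul]
    rcases eq_or_ne r 0 with h0 | h0
    · rw [h0] at hs₁u
      rw [Measure.measure_univ_eq_zero.1 hs₁u, smul_zero]
    · rw [ENNReal.inv_mul_cancel h0 hrtop, one_smul]
  have hR₂ : ρ.map Prod.snd = s₂ := by
    rw [hρ, Measure.map_smul, Measure.map_snd_prod, hs₁u, smul_smul]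
    rcases eq_or_ne r 0 with h0 | h0
    · rw [h0] at hs₂u
      rw [Measure.measure_univ_eq_zero.1 hs₂u, smul_zero]
    · rw [ENNReal.inv_mul_cancel h0 hrtop, one_smul]
  have hRu : ρ univ = r := by
    rw [← hs₁u, ← hR₁, Measure.map_apply measurable_fst MeasurableSet.univ, preimage_univ]
  have hm₁ : (γ + ρ).map Prod.fst = k₁ := by
    rw [Measure.map_add _ _ measurable_fst, hR₁, add_comm, hs₁,
      Measure.sub_add_cancel_of_le h₁]
  have hm₂ : (γ + ρ).map Prod.snd = k₂ := by
    rw [Measure.map_add _ _ measurable_snd, hR₂, add_comm, hs₂,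
      Measure.sub_add_cancel_of_le h₂]
  have hmem : γ + ρ ∈ Couplings k₁ k₂ := by
    refine ⟨⟨?_⟩, hm₁, hm₂⟩
    rw [Measure.add_apply, hRu, hr, add_tsub_cancel_of_le hγ1]
  calc transportCost c k₁ k₂ ≤ ∫⁻ p, c p.1 p.2 ∂(γ + ρ) := iInf₂_le _ hmem
    _ = (∫⁻ p, c p.1 p.2 ∂γ) + (∫⁻ p, c p.1 p.2 ∂ρ) := lintegral_add_measure _ _ _
    _ ≤ (∫⁻ p, c p.1 p.2 ∂γ) + (∫⁻ _, B ∂ρ) := by gcongr; exact hcB _ _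
    _ = _ := by rw [lintegral_const, hRu]

lemma transportCost_le_const {c : α → β → ℝ≥0∞} {B : ℝ≥0∞} (hcB : ∀ a b, c a b ≤ B)
    (k₁ : Measure α) (k₂ : Measure β) [IsProbabilityMeasure k₁] [IsProbabilityMeasure k₂] :
    transportCost c k₁ k₂ ≤ B := by
  have h := transportCost_le_of_subcoupling hcB (k₁ := k₁) (k₂ := k₂) (γ := 0)
    (by rw [Measure.map_zero]; exact Measure.zero_le _)
    (by rw [Measure.map_zero]; exact Measure.zero_le _)
  simpa using h

lemma transportCost_convex (c : α → β → ℝ≥0∞) (k k' : Measure α) (l : Measure β) :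
    transportCost c ((2⁻¹ : ℝ≥0∞) • (k + k')) l
      ≤ 2⁻¹ * (transportCost c k l + transportCost c k' l) := by
  have h2 : (2⁻¹ : ℝ≥0∞) ≠ ⊤ := by simp
  have key : ∀ γ ∈ Couplings k l, ∀ γ' ∈ Couplings k' l,
      transportCost c ((2⁻¹ : ℝ≥0∞) • (k + k')) l
        ≤ 2⁻¹ * ((∫⁻ p, c p.1 p.2 ∂γ) + ∫⁻ p, c p.1 p.2 ∂γ') := by
    intro γ hγ γ' hγ'
    have := hγ.1
    have := hγ'.1
    have hmem : (2⁻¹ : ℝ≥0∞) • (γ + γ') ∈ Couplings ((2⁻¹ : ℝ≥0∞) • (k + k')) l := by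
      refine ⟨⟨?_⟩, ?_, ?_⟩
      · rw [Measure.smul_apply, Measure.add_apply, measure_univ, measure_univ, smul_eq_mul,
          one_add_one_eq_two, ENNReal.inv_mul_cancel (by simp) (by simp)]
      · rw [Measure.map_smul, Measure.map_add _ _ measurable_fst, hγ.2.1, hγ'.2.1]
      · rw [Measure.map_smul, Measure.map_add _ _ measurable_snd, hγ.2.2, hγ'.2.2,
          ← two_smul ℝ≥0∞ l, smul_smul, ENNReal.inv_mul_cancel (by simp) (by simp), one_smul]
    refine (iInf₂_le _ hmem).trans_eq ?_
    rw [lintegral_smul_measure, lintegral_add_measure, smul_eq_mul]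
  rw [transportCost, transportCost, transportCost, ENNReal.iInf_add, ENNReal.mul_iInf_of_ne
    (by simp) h2]
  refine le_iInf fun γ => ?_
  rw [ENNReal.iInf_add, ENNReal.mul_iInf_of_ne (by simp) h2]
  refine le_iInf fun hγ => ?_
  rw [ENNReal.add_iInf, ENNReal.mul_iInf_of_ne (by simp) h2]
  refine le_iInf fun γ' => ?_
  rw [ENNReal.add_iInf, ENNReal.mul_iInf_of_ne (by simp) h2]
  exact le_iInf fun hγ' => key γ hγ γ' hγ'

/-- Lipschitz dependence of the transport cost on the density of its first argument. -/
lemma transportCost_withDensity_le {c : α → β → ℝ≥0∞} {B : ℝ≥0∞} (hcB : ∀ a b, c a b ≤ B)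
    {l : Measure α} {f f' : α → ℝ≥0∞} (hf : Measurable f) (hf' : Measurable f')
    [IsProbabilityMeasure (l.withDensity f)] [IsProbabilityMeasure (l.withDensity f')]
    (k : Measure β) [IsProbabilityMeasure k] :
    transportCost c (l.withDensity f) k
      ≤ transportCost c (l.withDensity f') k + B * ∫⁻ x, (f' x - f x) ∂l := by
  have key : ∀ γ ∈ Couplings (l.withDensity f') k, transportCost c (l.withDensity f) k
      ≤ (∫⁻ p, c p.1 p.2 ∂γ) + B * ∫⁻ x, (f' x - f x) ∂l := by
    intro γ hγ
    set h : α → ℝ≥0∞ := fun x => min (f x / f' x) 1 with hh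
    have hmeas : Measurable h := (hf.div hf').min measurable_const
    have hmeas' : Measurable fun p : α × β => h p.1 := hmeas.comp measurable_fst
    have hle : γ.withDensity (fun p => h p.1) ≤ γ := by
      calc _ ≤ γ.withDensity 1 :=
            withDensity_mono (Eventually.of_forall fun p => min_le_right _ _)
        _ = γ := withDensity_one
    have hfst : (γ.withDensity fun p => h p.1).map Prod.fst
        = l.withDensity (fun x => f' x * h x) := by
      ext s hs
      rw [Measure.map_apply measurable_fst hs, withDensity_apply _ (measurable_fst hs),
        ← setLIntegral_map hs hmeas measurable_fst, hγ.2.1,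
        setLIntegral_withDensity_eq_setLIntegral_mul _ hf' hmeas hs, withDensity_apply _ hs]
      rfl
    have h₁ : (γ.withDensity fun p => h p.1).map Prod.fst ≤ l.withDensity f := by
      rw [hfst]
      refine withDensity_mono (Eventually.of_forall fun x => ?_)
      calc f' x * h x ≤ f' x * (f x / f' x) := by gcongr; exact min_le_left _ _
        _ ≤ f x := ENNReal.mul_div_le
    have h₂ : (γ.withDensity fun p => h p.1).map Prod.snd ≤ k := by
      rw [← hγ.2.2]; exact Measure.map_mono hle measurable_snd
    refine (transportCost_le_of_subcoupling hcB h₁ h₂).trans ?_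
    gcongr
    have hu : (γ.withDensity fun p => h p.1) univ = ∫⁻ x, f' x * h x ∂l := by
      have := congrArg (fun m => m univ) hfst
      simpa [Measure.map_apply measurable_fst MeasurableSet.univ,
        withDensity_apply _ MeasurableSet.univ] using this
    have h1 : (1 : ℝ≥0∞) = ∫⁻ x, f' x ∂l := by
      rw [← setLIntegral_univ, ← withDensity_apply _ MeasurableSet.univ, measure_univ]
    have hfin : ∀ᵐ x ∂l, f' x < ⊤ := ae_lt_top hf' (by rw [← h1]; simp)
    have hfm : Measurable fun x => f' x * h x := hf'.mul hmeas
    rw [hu, tsub_le_iff_right, h1,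
      ← lintegral_add_right (fun x => f' x - f x) hfm]
    refine lintegral_mono_ae ?_
    filter_upwards [hfin] with x hx
    rcases eq_or_ne (f' x) 0 with h0 | h0
    · simp [h0]
    rcases le_total (f x) (f' x) with hle' | hle'
    · have : h x = f x / f' x := min_eq_left (ENNReal.div_le_of_le_mul (by simpa using hle'))
      rw [this, ENNReal.mul_div_cancel h0 hx.ne, tsub_add_cancel_of_le hle']
    · have : h x = 1 :=
        min_eq_right ((ENNReal.le_div_iff_mul_le (Or.inl h0) (Or.inl hx.ne)).2 (by simpa using hle'))
      rw [this, mul_one]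
      exact le_add_self
  rw [transportCost, transportCost, ENNReal.iInf_add]
  refine le_iInf fun γ => ?_
  rw [ENNReal.iInf_add]
  exact le_iInf fun hγ => key γ hγ

end Transport

section Measurability

variable {α β : Type*} [MeasurableSpace α] [MeasurableSpace β]

/-- Mass prescribed on the cells of a countable partition gives an upper bound on the cost. -/
lemma transportCost_le_of_cells {c : α → α → ℝ≥0∞} {B : ℝ≥0∞} (hcB : ∀ a b, c a b ≤ B)
    {A : ℕ → Set α} (hA : ∀ i, MeasurableSet (A i)) (hdisj : Pairwise (Function.onFun Disjoint A))
    (hcov : ⋃ i, A i = univ) {M : ℕ × ℕ → ℝ≥0∞}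
    (hM : ∀ i j, ∀ a ∈ A i, ∀ b ∈ A j, c a b ≤ M (i, j))
    {k₁ k₂ : Measure α} [IsProbabilityMeasure k₁] [IsProbabilityMeasure k₂]
    {q : ℕ × ℕ → ℝ≥0∞} (h₁ : ∀ i, ∑' j, q (i, j) ≤ k₁ (A i))
    (h₂ : ∀ j, ∑' i, q (i, j) ≤ k₂ (A j)) :
    transportCost c k₁ k₂ ≤ ∑' p, q p * M p + B * (1 - ∑' p, q p) := by
  set w : ℕ × ℕ → ℝ≥0∞ := fun p => q p * (k₁ (A p.1))⁻¹ * (k₂ (A p.2))⁻¹ with hw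
  set γ : Measure (α × α) := Measure.sum fun p : ℕ × ℕ =>
    w p • (k₁.restrict (A p.1)).prod (k₂.restrict (A p.2)) with hγ
  have hwmass : ∀ p, w p * (k₁ (A p.1) * k₂ (A p.2)) = q p := by
    rintro ⟨i, j⟩
    have hi : q (i, j) ≤ k₁ (A i) := (ENNReal.le_tsum j).trans (h₁ i)
    have hj : q (i, j) ≤ k₂ (A j) := (ENNReal.le_tsum (f := fun i => q (i, j)) i).trans (h₂ j)
    rcases eq_or_ne (k₁ (A i)) 0 with h0 | h0
    · have : q (i, j) = 0 := by simpa [h0] using hi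
      simp [hw, this]
    rcases eq_or_ne (k₂ (A j)) 0 with h0' | h0'
    · have : q (i, j) = 0 := by simpa [h0'] using hj
      simp [hw, this]
    simp only [hw]
    calc q (i, j) * (k₁ (A i))⁻¹ * (k₂ (A j))⁻¹ * (k₁ (A i) * k₂ (A j))
        = q (i, j) * ((k₁ (A i))⁻¹ * k₁ (A i)) * ((k₂ (A j))⁻¹ * k₂ (A j)) := by ring
      _ = q (i, j) := by
        rw [ENNReal.inv_mul_cancel h0 (measure_ne_top _ _),
          ENNReal.inv_mul_cancel h0' (measure_ne_top _ _), mul_one, mul_one]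
  have hsum : ∀ (k : Measure α) (s : Set α), MeasurableSet s → ∑' i, k (s ∩ A i) = k s := by
    intro k s hs
    rw [← measure_iUnion (fun i j hij => (hdisj hij).mono inter_subset_right inter_subset_right)
      (fun i => hs.inter (hA i)), ← inter_iUnion, hcov, inter_univ]
  have hm₁ : γ.map Prod.fst ≤ k₁ := by
    refine Measure.le_iff.2 fun s hs => ?_
    rw [Measure.map_apply measurable_fst hs, hγ, Measure.sum_apply _ (measurable_fst hs),
      ENNReal.tsum_prod', ← hsum k₁ s hs]
    refine ENNReal.tsum_le_tsum fun i => ?_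
    calc ∑' j, (w (i, j) • (k₁.restrict (A i)).prod (k₂.restrict (A j))) (Prod.fst ⁻¹' s)
        ≤ ∑' j, q (i, j) * ((k₁ (A i))⁻¹ * k₁ (s ∩ A i)) := by
          refine ENNReal.tsum_le_tsum fun j => ?_
          rw [Measure.smul_apply, ← prod_univ, Measure.prod_prod, Measure.restrict_apply hs,
            Measure.restrict_apply_univ, smul_eq_mul]
          simp only [hw]
          calc q (i, j) * (k₁ (A i))⁻¹ * (k₂ (A j))⁻¹ * (k₁ (s ∩ A i) * k₂ (A j))
              = q (i, j) * ((k₁ (A i))⁻¹ * k₁ (s ∩ A i)) * ((k₂ (A j))⁻¹ * k₂ (A j)) := by ring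
            _ ≤ q (i, j) * ((k₁ (A i))⁻¹ * k₁ (s ∩ A i)) * 1 := by
              gcongr; exact ENNReal.inv_mul_le_one _
            _ = _ := mul_one _
      _ ≤ k₁ (A i) * ((k₁ (A i))⁻¹ * k₁ (s ∩ A i)) := by
          rw [ENNReal.tsum_mul_right]; gcongr; exact h₁ i
      _ = (k₁ (A i) * (k₁ (A i))⁻¹) * k₁ (s ∩ A i) := by ring
      _ ≤ 1 * k₁ (s ∩ A i) := by gcongr; exact ENNReal.mul_inv_le_one _
      _ = _ := one_mul _
  have hm₂ : γ.map Prod.snd ≤ k₂ := by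
    refine Measure.le_iff.2 fun s hs => ?_
    rw [Measure.map_apply measurable_snd hs, hγ, Measure.sum_apply _ (measurable_snd hs),
      ENNReal.tsum_prod', ENNReal.tsum_comm, ← hsum k₂ s hs]
    refine ENNReal.tsum_le_tsum fun j => ?_
    calc ∑' i, (w (i, j) • (k₁.restrict (A i)).prod (k₂.restrict (A j))) (Prod.snd ⁻¹' s)
        ≤ ∑' i, q (i, j) * ((k₂ (A j))⁻¹ * k₂ (s ∩ A j)) := by
          refine ENNReal.tsum_le_tsum fun i => ?_
          rw [Measure.smul_apply, ← univ_prod, Measure.prod_prod, Measure.restrict_apply hs,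
            Measure.restrict_apply_univ, smul_eq_mul]
          simp only [hw]
          calc q (i, j) * (k₁ (A i))⁻¹ * (k₂ (A j))⁻¹ * (k₁ (A i) * k₂ (s ∩ A j))
              = q (i, j) * ((k₂ (A j))⁻¹ * k₂ (s ∩ A j)) * ((k₁ (A i))⁻¹ * k₁ (A i)) := by ring
            _ ≤ q (i, j) * ((k₂ (A j))⁻¹ * k₂ (s ∩ A j)) * 1 := by
              gcongr; exact ENNReal.inv_mul_le_one _
            _ = _ := mul_one _
      _ ≤ k₂ (A j) * ((k₂ (A j))⁻¹ * k₂ (s ∩ A j)) := by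
          rw [ENNReal.tsum_mul_right]; gcongr; exact h₂ j
      _ = (k₂ (A j) * (k₂ (A j))⁻¹) * k₂ (s ∩ A j) := by ring
      _ ≤ 1 * k₂ (s ∩ A j) := by gcongr; exact ENNReal.mul_inv_le_one _
      _ = _ := one_mul _
  have hu : γ univ = ∑' p, q p := by
    rw [hγ, Measure.sum_apply _ MeasurableSet.univ]
    refine tsum_congr fun p => ?_
    rw [Measure.smul_apply, ← univ_prod_univ, Measure.prod_prod, Measure.restrict_apply_univ,
      Measure.restrict_apply_univ, smul_eq_mul, hwmass]
  have hcost : ∫⁻ p, c p.1 p.2 ∂γ ≤ ∑' p, q p * M p := by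
    rw [hγ, lintegral_sum_measure]
    refine ENNReal.tsum_le_tsum fun p => ?_
    rw [lintegral_smul_measure, Measure.prod_restrict, smul_eq_mul]
    calc w p * ∫⁻ x in A p.1 ×ˢ A p.2, c x.1 x.2 ∂(k₁.prod k₂)
        ≤ w p * ∫⁻ x in A p.1 ×ˢ A p.2, M p ∂(k₁.prod k₂) := by
          refine mul_le_mul_right ?_ _
          exact setLIntegral_mono' ((hA _).prod (hA _)) fun x hx => hM _ _ _ hx.1 _ hx.2
      _ = w p * (k₁ (A p.1) * k₂ (A p.2)) * M p := by
          rw [setLIntegral_const, Measure.prod_prod]; ring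
      _ = q p * M p := by rw [hwmass]
  refine (transportCost_le_of_subcoupling hcB hm₁ hm₂).trans ?_
  rw [hu]
  gcongr

/-- Approximation from below of a summable family by rational, finitely supported ones. -/
lemma exists_finsupp_le_tsum_sub_le {ι : Type*} (g : ι → ℝ≥0∞) (hg : ∑' i, g i ≠ ⊤)
    {ε : ℝ≥0∞} (hε : ε ≠ 0) :
    ∃ q : ι →₀ ℚ≥0, (∀ i, ((q i : NNReal) : ℝ≥0∞) ≤ g i) ∧
      ∑' i, g i ≤ ∑' i, ((q i : NNReal) : ℝ≥0∞) + ε := by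
  classical
  have hg' : ∀ i, g i ≠ ⊤ := fun i => ne_top_of_le_ne_top hg (ENNReal.le_tsum i)
  have hrat : ∀ x : ℝ≥0∞, x ≠ ⊤ → ∀ δ : ℝ≥0∞, δ ≠ 0 →
      ∃ r : ℚ≥0, ((r : NNReal) : ℝ≥0∞) ≤ x ∧ x ≤ ((r : NNReal) : ℝ≥0∞) + δ := by
    intro x hx δ hδ
    rcases eq_or_ne x 0 with rfl | h0
    · exact ⟨0, by simp, by simp⟩
    obtain ⟨r, hr0, hr1, hr2⟩ := ENNReal.lt_iff_exists_rat_btwn.1 (ENNReal.sub_lt_self hx h0 hδ)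
    lift r to ℚ≥0 using hr0
    have hcast : ((r : ℚ) : ℝ).toNNReal = (r : NNReal) := by
      ext
      rw [Real.coe_toNNReal _ (by exact_mod_cast r.2)]
      simp
      rfl
    rw [hcast] at hr1 hr2
    exact ⟨r, hr2.le, tsub_le_iff_right.1 hr1.le⟩
  have hε2 : ε / 2 ≠ 0 := by simp [hε]
  obtain ⟨F, hF⟩ : ∃ F : Finset ι, ∑' i, g i ≤ ∑ i ∈ F, g i + ε / 2 := by
    rcases eq_or_ne (∑' i, g i) 0 with h0 | h0
    · exact ⟨∅, by simp [h0]⟩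
    have := ENNReal.sub_lt_self hg h0 hε2
    rw [ENNReal.tsum_eq_iSup_sum] at this
    obtain ⟨F, hF⟩ := lt_iSup_iff.1 this
    rw [← ENNReal.tsum_eq_iSup_sum] at hF
    exact ⟨F, tsub_le_iff_right.1 hF.le⟩
  have hδ : ε / 2 / (F.card + 1) ≠ 0 := by
    refine (ENNReal.div_pos hε2 ?_).ne'
    exact ENNReal.add_ne_top.2 ⟨ENNReal.natCast_ne_top _, ENNReal.one_ne_top⟩
  choose r hr1 hr2 using fun i => hrat (g i) (hg' i) _ hδ
  refine ⟨Finsupp.onFinset F (fun i => if i ∈ F then r i else 0) (by simp +contextual), ?_, ?_⟩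
  · intro i
    simp only [Finsupp.onFinset_apply]
    split_ifs
    · exact hr1 i
    · simp
  · calc ∑' i, g i ≤ ∑ i ∈ F, g i + ε / 2 := hF
      _ ≤ ∑ i ∈ F, (((r i : NNReal) : ℝ≥0∞) + ε / 2 / (F.card + 1)) + ε / 2 := by
          gcongr with i hi; exact hr2 i
      _ = ∑ i ∈ F, ((r i : NNReal) : ℝ≥0∞) + F.card * (ε / 2 / (F.card + 1)) + ε / 2 := by
          rw [Finset.sum_add_distrib, Finset.sum_const, nsmul_eq_mul]
      _ ≤ ∑ i ∈ F, ((r i : NNReal) : ℝ≥0∞) + ε / 2 + ε / 2 := by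
          gcongr
          calc (F.card : ℝ≥0∞) * (ε / 2 / (F.card + 1))
              ≤ (F.card + 1) * (ε / 2 / (F.card + 1)) := by gcongr; exact le_self_add
            _ ≤ ε / 2 := ENNReal.mul_div_le
      _ = ∑ i ∈ F, ((r i : NNReal) : ℝ≥0∞) + ε := by rw [add_assoc, ENNReal.add_halves]
      _ ≤ _ := by
          gcongr
          refine le_trans (le_of_eq ?_) (ENNReal.sum_le_tsum F)
          refine Finset.sum_congr rfl fun i hi => ?_
          simp [hi]

/-- Transport cost between two kernels is measurable when the cost is bounded and has small
oscillation on the cells of suitable countable partitions. -/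
lemma measurable_transportCost {c : α → α → ℝ≥0∞} {B : ℝ≥0∞} (hB : B ≠ ⊤)
    (hcB : ∀ a b, c a b ≤ B)
    (hosc : ∀ ε : ℝ≥0∞, ε ≠ 0 → ∃ A : ℕ → Set α, (∀ i, MeasurableSet (A i)) ∧
      Pairwise (Function.onFun Disjoint A) ∧ ⋃ i, A i = univ ∧
      ∀ i j, ∀ a ∈ A i, ∀ b ∈ A j, ∀ a' ∈ A i, ∀ b' ∈ A j, c a b ≤ c a' b' + ε)
    (K₁ K₂ : Kernel β α) [IsMarkovKernel K₁] [IsMarkovKernel K₂] :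
    Measurable fun y => transportCost c (K₁ y) (K₂ y) := by
  classical
  choose A hA hdisj hcov hAosc using fun n : ℕ => hosc ((n : ℝ≥0∞) + 1)⁻¹ (by simp)
  set M : ℕ → ℕ × ℕ → ℝ≥0∞ := fun n p => ⨆ a ∈ A n p.1, ⨆ b ∈ A n p.2, c a b with hM
  set Q : (ℕ × ℕ →₀ ℚ≥0) → ℕ × ℕ → ℝ≥0∞ := fun q p => ((q p : NNReal) : ℝ≥0∞) with hQ
  set P : ℕ → (ℕ × ℕ →₀ ℚ≥0) → β → Prop := fun n q y =>
    (∀ i, ∑' j, Q q (i, j) ≤ K₁ y (A n i)) ∧ ∀ j, ∑' i, Q q (i, j) ≤ K₂ y (A n j) with hP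
  have hform : (fun y => transportCost c (K₁ y) (K₂ y)) = fun y => ⨅ n, ⨅ q,
      if P n q y then ∑' p, Q q p * M n p + B * (1 - ∑' p, Q q p) else ⊤ := by
    funext y
    refine le_antisymm (le_iInf fun n => le_iInf fun q => ?_) ?_
    · split_ifs with h
      · refine transportCost_le_of_cells hcB (hA n) (hdisj n) (hcov n) ?_ h.1 h.2
        intro i j a ha b hb
        exact le_iSup₂_of_le a ha (le_iSup₂_of_le b hb le_rfl)
      · exact le_top
    · refine le_iInf₂ fun γ hγ => ?_
      have := hγ.1
      refine ENNReal.le_of_forall_pos_le_add fun η hη _ => ?_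
      have hη0 : (η : ℝ≥0∞) ≠ 0 := by exact_mod_cast hη.ne'
      obtain ⟨n, hn⟩ := ENNReal.exists_inv_nat_lt (a := (η : ℝ≥0∞) / 2) (by simp [hη0])
      have hn' : ((n : ℝ≥0∞) + 1)⁻¹ ≤ η / 2 :=
        (ENNReal.inv_le_inv.2 le_self_add).trans hn.le
      set g : ℕ × ℕ → ℝ≥0∞ := fun p => γ (A n p.1 ×ˢ A n p.2) with hg
      have hcell : ∀ p : ℕ × ℕ, MeasurableSet (A n p.1 ×ˢ A n p.2) :=
        fun p => (hA n _).prod (hA n _)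
      have hcdisj : Pairwise (Function.onFun Disjoint fun p : ℕ × ℕ => A n p.1 ×ˢ A n p.2) := by
        rintro ⟨i, j⟩ ⟨i', j'⟩ hne
        by_cases hi : i = i'
        · have hj : j ≠ j' := fun h => hne (by rw [hi, h])
          exact Disjoint.set_prod_right (hdisj n hj) _ _
        · exact Disjoint.set_prod_left (hdisj n hi) _ _
      have hccov : ⋃ p : ℕ × ℕ, A n p.1 ×ˢ A n p.2 = univ := by
        rw [iUnion_prod, hcov, univ_prod_univ]
      have hgsum : ∑' p, g p = 1 := by
        rw [hg, ← measure_iUnion hcdisj hcell, hccov, measure_univ]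
      have hε : (η : ℝ≥0∞) / 2 / (B + 1) ≠ 0 :=
        (ENNReal.div_pos (by simp [hη0]) (by simp [hB])).ne'
      obtain ⟨q, hqg, hq⟩ := exists_finsupp_le_tsum_sub_le g (by rw [hgsum]; simp) hε
      have hfeas : P n q y := by
        constructor
        · intro i
          calc ∑' j, Q q (i, j) ≤ ∑' j, g (i, j) := ENNReal.tsum_le_tsum fun j => hqg _
            _ = γ (⋃ j, A n i ×ˢ A n j) := by
              rw [measure_iUnion _ fun j => hcell (i, j)]
              exact fun j j' hj => Disjoint.set_prod_right (hdisj n hj) _ _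
            _ = K₁ y (A n i) := by
              rw [← prod_iUnion, hcov, prod_univ, ← Measure.map_apply measurable_fst (hA n i),
                hγ.2.1]
        · intro j
          calc ∑' i, Q q (i, j) ≤ ∑' i, g (i, j) := ENNReal.tsum_le_tsum fun i => hqg _
            _ = γ (⋃ i, A n i ×ˢ A n j) := by
              rw [measure_iUnion _ fun i => hcell (i, j)]
              exact fun i i' hi => Disjoint.set_prod_left (hdisj n hi) _ _
            _ = K₂ y (A n j) := by
              rw [← iUnion_prod_const, hcov, univ_prod, ← Measure.map_apply measurable_snd (hA n j),
                hγ.2.2]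
      refine (iInf₂_le n q).trans ?_
      rw [if_pos hfeas]
      have hcost : ∑' p, Q q p * M n p ≤ (∫⁻ x, c x.1 x.2 ∂γ) + η / 2 := by
        calc ∑' p, Q q p * M n p ≤ ∑' p, g p * M n p :=
              ENNReal.tsum_le_tsum fun p => by gcongr; exact hqg p
          _ ≤ ∑' p : ℕ × ℕ, ∫⁻ x in A n p.1 ×ˢ A n p.2, (c x.1 x.2 + η / 2) ∂γ := by
              refine ENNReal.tsum_le_tsum fun p => ?_
              rw [mul_comm, hg, ← setLIntegral_const]
              refine setLIntegral_mono' (hcell p) fun x hx => ?_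
              refine iSup₂_le fun a ha => iSup₂_le fun b hb => ?_
              exact (hAosc n _ _ a ha b hb _ hx.1 _ hx.2).trans (by gcongr)
          _ = ∫⁻ x, (c x.1 x.2 + η / 2) ∂γ := by
              rw [← lintegral_iUnion hcell hcdisj, hccov, setLIntegral_univ]
          _ = _ := by rw [lintegral_add_right _ measurable_const, lintegral_const, measure_univ,
                mul_one]
      have hmass : B * (1 - ∑' p, Q q p) ≤ η / 2 := by
        rw [hgsum] at hq
        calc B * (1 - ∑' p, Q q p) ≤ (B + 1) * ((η : ℝ≥0∞) / 2 / (B + 1)) := by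
              gcongr
              · exact le_self_add
              · exact tsub_le_iff_left.2 hq
          _ ≤ η / 2 := ENNReal.mul_div_le
      calc _ ≤ (∫⁻ x, c x.1 x.2 ∂γ) + η / 2 + η / 2 := add_le_add hcost hmass
        _ = _ := by rw [add_assoc, ENNReal.add_halves]
  rw [hform]
  refine Measurable.iInf fun n => Measurable.iInf fun q => ?_
  refine Measurable.ite ?_ measurable_const measurable_const
  simp only [hP, ofPred_and, ofPred_forall]
  refine (MeasurableSet.iInter fun i => ?_).inter (MeasurableSet.iInter fun j => ?_)
  · exact measurableSet_le measurable_const (K₁.measurable_coe (hA n i))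
  · exact measurableSet_le measurable_const (K₂.measurable_coe (hA n j))

end Measurability

section TruncatedCost

variable {α : Type*} [PseudoEMetricSpace α]

/-- The squared distance, truncated at `D`. -/
def truncCost (D : ℝ≥0∞) (a b : α) : ℝ≥0∞ := min (edist a b) D ^ 2

lemma truncCost_le (D : ℝ≥0∞) (a b : α) : truncCost D a b ≤ D ^ 2 := by
  unfold truncCost
  gcongr
  exact min_le_right _ _

variable [MeasurableSpace α]

lemma exists_partition_truncCost_le [TopologicalSpace.SeparableSpace α] [OpensMeasurableSpace α]
    [Nonempty α] {D : ℝ≥0∞} (hD : D ≠ ⊤) {ε : ℝ≥0∞} (hε : ε ≠ 0) :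
    ∃ A : ℕ → Set α, (∀ i, MeasurableSet (A i)) ∧
      Pairwise (Function.onFun Disjoint A) ∧ ⋃ i, A i = univ ∧
      ∀ i j, ∀ a ∈ A i, ∀ b ∈ A j, ∀ a' ∈ A i, ∀ b' ∈ A j,
        truncCost D a b ≤ truncCost D a' b' + ε := by
  set δ : ℝ≥0∞ := min 1 (ε / (16 * (D + 1))) with hδdef
  have hδ0 : 0 < δ := lt_min one_pos (ENNReal.div_pos hε
    (ENNReal.mul_ne_top (by simp) (ENNReal.add_ne_top.2 ⟨hD, by simp⟩)))
  have hδ1 : δ ≤ 1 := min_le_left _ _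
  have hδε : 16 * (D + 1) * δ ≤ ε := by
    calc 16 * (D + 1) * δ ≤ 16 * (D + 1) * (ε / (16 * (D + 1))) := by
          gcongr; exact min_le_right _ _
      _ ≤ ε := ENNReal.mul_div_le
  set u := TopologicalSpace.denseSeq α
  set S : ℕ → Set α := fun i => {x | edist x (u i) < δ} with hS
  have hSm : ∀ i, MeasurableSet (S i) := fun i =>
    (isOpen_lt (continuous_id.edist continuous_const) continuous_const).measurableSet
  refine ⟨disjointed S, fun i => .disjointed hSm i, disjoint_disjointed S, ?_, ?_⟩
  · rw [iUnion_disjointed]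
    refine eq_univ_of_forall fun x => mem_iUnion.2 ?_
    obtain ⟨i, hi⟩ := (TopologicalSpace.denseRange_denseSeq α).exists_mem_open
      (isOpen_lt (continuous_const.edist continuous_id) continuous_const :
        IsOpen {z | edist x z < δ}) ⟨x, by simpa using hδ0⟩
    exact ⟨i, hi⟩
  · have hdiam : ∀ i, ∀ a ∈ disjointed S i, ∀ a' ∈ disjointed S i, edist a a' ≤ δ + δ := by
      intro i a ha a' ha'
      have h1 : edist a (u i) < δ := disjointed_subset S i ha
      have h2 : edist a' (u i) < δ := disjointed_subset S i ha'
      calc edist a a' ≤ edist a (u i) + edist (u i) a' := edist_triangle _ _ _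
        _ ≤ δ + δ := by rw [edist_comm (u i)]; exact add_le_add h1.le h2.le
    intro i j a ha b hb a' ha' b' hb'
    have h : edist a b ≤ edist a' b' + 4 * δ := by
      calc edist a b ≤ edist a a' + edist a' b' + edist b' b := edist_triangle4 _ _ _ _
        _ ≤ (δ + δ) + edist a' b' + (δ + δ) := by
          gcongr
          · exact hdiam i a ha a' ha'
          · exact hdiam j b' hb' b hb
        _ = _ := by ring
    set m := min (edist a' b') D with hm
    have hmD : m ≤ D := min_le_right _ _
    have h' : min (edist a b) D ≤ m + 4 * δ := by
      rw [hm, min_add]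
      exact min_le_min h le_self_add
    calc truncCost D a b ≤ (m + 4 * δ) ^ 2 := by unfold truncCost; gcongr
      _ = m ^ 2 + (8 * m + 16 * δ) * δ := by ring
      _ ≤ m ^ 2 + (16 * D + 16 * 1) * δ := by gcongr; norm_num
      _ = m ^ 2 + 16 * (D + 1) * δ := by ring
      _ ≤ truncCost D a' b' + ε := by unfold truncCost; gcongr

lemma W2sq_eq_transportCost_truncCost {X : Set α} {D : ℝ≥0∞}
    (hXD : ∀ a ∈ X, ∀ b ∈ X, edist a b ≤ D) {k₁ k₂ : Measure α} (h₁ : k₁ Xᶜ = 0)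
    (h₂ : k₂ Xᶜ = 0) : W2sq k₁ k₂ = transportCost (truncCost D) k₁ k₂ := by
  refine iInf_congr fun γ => iInf_congr fun hγ => lintegral_congr_ae ?_
  have a1 : ∀ᵐ p ∂γ, p.1 ∈ X := by
    refine ae_of_ae_map (f := Prod.fst) (p := fun a => a ∈ X) measurable_fst.aemeasurable ?_
    rw [hγ.2.1]; exact h₁
  have a2 : ∀ᵐ p ∂γ, p.2 ∈ X := by
    refine ae_of_ae_map (f := Prod.snd) (p := fun a => a ∈ X) measurable_snd.aemeasurable ?_
    rw [hγ.2.2]; exact h₂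
  filter_upwards [a1, a2] with p h1 h2
  rw [truncCost, min_eq_left (hXD _ h1 _ h2)]

end TruncatedCost

section Disintegration

variable {α β : Type*} [MeasurableSpace α] [MeasurableSpace β] {ν : Measure β}
  [IsProbabilityMeasure ν]

lemma IsDisint.map_swap {ρ : Measure (α × β)} {K : Kernel β α} (h : IsDisint ν ρ K) :
    ρ.map Prod.swap = ν ⊗ₘ K := by
  have := h.1
  refine (Measure.ext_prod fun {t s} ht hs => ?_).symm
  rw [Measure.compProd_apply_prod ht hs, Measure.map_apply measurable_swap (ht.prod hs),
    preimage_swap_prod, h.2 s t hs ht]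

lemma IsDisint.ae_eq [MeasurableSpace.CountableOrCountablyGenerated β α] {ρ : Measure (α × β)}
    {K K' : Kernel β α} (h : IsDisint ν ρ K) (h' : IsDisint ν ρ K') : ∀ᵐ y ∂ν, K y = K' y := by
  have := h.1
  have := h'.1
  exact Kernel.ae_eq_of_compProd_eq (h.map_swap.symm.trans h'.map_swap)

lemma exists_isDisint [StandardBorelSpace α] [Nonempty α] {ρ : Measure (α × β)}
    [IsFiniteMeasure ρ] (hρ : ρ.map Prod.snd = ν) : ∃ K : Kernel β α, IsDisint ν ρ K := by
  refine ⟨(ρ.map Prod.swap).condKernel, inferInstance, fun s t hs ht => ?_⟩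
  have h := (ρ.map Prod.swap).disintegrate (ρ.map Prod.swap).condKernel
  have hfst : (ρ.map Prod.swap).fst = ν := by
    rw [Measure.fst_map_swap]; exact hρ
  rw [hfst] at h
  rw [← Measure.compProd_apply_prod ht hs, h, Measure.map_apply measurable_swap (ht.prod hs),
    preimage_swap_prod]

lemma WFsq_eq [PseudoEMetricSpace α] [MeasurableSpace.CountableOrCountablyGenerated β α]
    {ρ₁ ρ₂ : Measure (α × β)} {K₁ K₂ : Kernel β α} (h₁ : IsDisint ν ρ₁ K₁)
    (h₂ : IsDisint ν ρ₂ K₂) : WFsq ν ρ₁ ρ₂ = ∫⁻ y, W2sq (K₁ y) (K₂ y) ∂ν := by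
  refine le_antisymm (iInf_le_of_le K₁ (iInf_le_of_le K₂ (iInf₂_le h₁ h₂))) ?_
  refine le_iInf fun K₁' => le_iInf fun K₂' => le_iInf₂ fun h₁' h₂' => le_of_eq ?_
  refine lintegral_congr_ae ?_
  filter_upwards [h₁.ae_eq h₁', h₂.ae_eq h₂'] with y e₁ e₂
  rw [e₁, e₂]

omit [IsProbabilityMeasure ν] in
lemma IsDisint.ae_apply_eq_zero {ρ : Measure (α × β)} {K : Kernel β α} (h : IsDisint ν ρ K)
    {s : Set α} (hs : MeasurableSet s) (hρ : ρ (s ×ˢ univ) = 0) : ∀ᵐ y ∂ν, K y s = 0 := by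
  rw [h.2 s univ hs MeasurableSet.univ, setLIntegral_univ,
    lintegral_eq_zero_iff (K.measurable_coe hs)] at hρ
  exact hρ

omit [IsProbabilityMeasure ν] in
lemma IsDisint.midpoint {ρ ρ' : Measure (α × β)} {K K' : Kernel β α} (h : IsDisint ν ρ K)
    (h' : IsDisint ν ρ' K') : ∃ L : Kernel β α,
      IsDisint ν ((2⁻¹ : ℝ≥0∞) • (ρ + ρ')) L ∧ ∀ y, L y = (2⁻¹ : ℝ≥0∞) • (K y + K' y) := by
  have := h.1
  have := h'.1
  refine ⟨⟨fun y => (2⁻¹ : ℝ≥0∞) • (K y + K' y), ?_⟩, ⟨⟨fun y => ⟨?_⟩⟩, fun s t hs ht => ?_⟩,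
    fun y => rfl⟩
  · refine Measure.measurable_of_measurable_coe _ fun s hs => ?_
    exact ((K.measurable_coe hs).add (K'.measurable_coe hs)).const_mul _
  · change (2⁻¹ : ℝ≥0∞) * (K y univ + K' y univ) = 1
    rw [measure_univ, measure_univ, one_add_one_eq_two,
      ENNReal.inv_mul_cancel (by simp) (by simp)]
  · change (2⁻¹ : ℝ≥0∞) * (ρ (s ×ˢ t) + ρ' (s ×ˢ t)) = ∫⁻ y in t, 2⁻¹ * (K y s + K' y s) ∂ν
    have hm : Measurable fun y => K y s + K' y s :=
      (K.measurable_coe hs).add (K'.measurable_coe hs)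
    rw [lintegral_const_mul _ hm,
      lintegral_add_left (K.measurable_coe hs), h.2 s t hs ht, h'.2 s t hs ht]

lemma IsDisint.ae_eq_withDensity [MeasurableSpace.CountableOrCountablyGenerated β α]
    {l : Measure α} [IsFiniteMeasure l] {f : α × β → ℝ≥0∞} (hf : Measurable f)
    (hν : ((l.prod ν).withDensity f).map Prod.snd = ν) {K : Kernel β α}
    (h : IsDisint ν ((l.prod ν).withDensity f) K) :
    ∀ᵐ y ∂ν, K y = l.withDensity fun x => f (x, y) := by
  classical
  have := h.1
  have hrect : ∀ s : Set α, ∀ t : Set β, MeasurableSet s → MeasurableSet t →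
      (l.prod ν).withDensity f (s ×ˢ t) = ∫⁻ y in t, ∫⁻ x in s, f (x, y) ∂l ∂ν := by
    intro s t hs ht
    rw [withDensity_apply _ (hs.prod ht), ← Measure.prod_restrict,
      lintegral_prod_symm _ hf.aemeasurable]
  have hm : Measurable fun y => ∫⁻ x, f (x, y) ∂l := hf.lintegral_prod_left'
  have hone : ∀ᵐ y ∂ν, ∫⁻ x, f (x, y) ∂l = 1 := by
    refine ae_eq_of_forall_setLIntegral_eq_of_sigmaFinite hm measurable_const fun t ht _ => ?_
    have := congrArg (fun m => m t) hν
    simp only [Measure.map_apply measurable_snd ht, ← univ_prod, hrect univ t .univ ht,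
      setLIntegral_univ] at this
    rw [this, setLIntegral_one]
  set S : Set β := {y | ∫⁻ x, f (x, y) ∂l = 1} with hS
  have hSm : MeasurableSet S := measurableSet_eq_fun hm measurable_const
  have hfm : Measurable (Function.uncurry fun (y : β) (x : α) => f (x, y)) :=
    hf.comp measurable_swap
  set L : Kernel β α := Kernel.piecewise hSm
    (Kernel.withDensity (Kernel.const β l) fun y x => f (x, y)) K with hL
  have hLS : ∀ y ∈ S, L y = l.withDensity fun x => f (x, y) := by
    intro y hy
    rw [hL, Kernel.piecewise_apply, if_pos hy, Kernel.withDensity_apply _ hfm, Kernel.const_apply]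
  have hLmark : IsMarkovKernel L := by
    refine ⟨fun y => ?_⟩
    by_cases hy : y ∈ S
    · rw [hLS y hy]
      exact ⟨by rw [withDensity_apply _ .univ, setLIntegral_univ]; exact hy⟩
    · rw [hL, Kernel.piecewise_apply, if_neg hy]; infer_instance
  have hdis : IsDisint ν ((l.prod ν).withDensity f) L := by
    refine ⟨hLmark, fun s t hs ht => ?_⟩
    rw [hrect s t hs ht]
    refine lintegral_congr_ae (ae_restrict_of_ae ?_)
    filter_upwards [hone] with y hy
    rw [hLS y hy, withDensity_apply _ hs]
  filter_upwards [h.ae_eq hdis, hone] with y h1 h2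
  rw [h1, hLS y h2]

end Disintegration

section FiberedWasserstein

variable {α β : Type*} [MeasurableSpace α] [MeasurableSpace β] [PseudoEMetricSpace α]
  [StandardBorelSpace α] [Nonempty α] {X : Set α} {D : ℝ≥0∞} {μ : Measure α} {ν : Measure β}
  [IsProbabilityMeasure ν]

omit [PseudoEMetricSpace α] in
lemma exists_isDisint_of_mem_couplings (hX : MeasurableSet X) (hμ : μ Xᶜ = 0)
    {ρ : Measure (α × β)} (hρ : ρ ∈ Couplings μ ν) :
    ∃ K : Kernel β α, IsDisint ν ρ K ∧ ∀ᵐ y ∂ν, K y Xᶜ = 0 := by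
  have := hρ.1
  obtain ⟨K, hK⟩ := exists_isDisint hρ.2.2
  refine ⟨K, hK, hK.ae_apply_eq_zero hX.compl ?_⟩
  rw [prod_univ, ← Measure.map_apply measurable_fst hX.compl, hρ.2.1, hμ]

omit [Nonempty α] in
lemma WFsq_eq_lintegral_truncCost (hXD : ∀ a ∈ X, ∀ b ∈ X, edist a b ≤ D)
    {ρ₁ ρ₂ : Measure (α × β)} {K₁ K₂ : Kernel β α}
    (h₁ : IsDisint ν ρ₁ K₁) (h₂ : IsDisint ν ρ₂ K₂) (n₁ : ∀ᵐ y ∂ν, K₁ y Xᶜ = 0)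
    (n₂ : ∀ᵐ y ∂ν, K₂ y Xᶜ = 0) :
    WFsq ν ρ₁ ρ₂ = ∫⁻ y, transportCost (truncCost D) (K₁ y) (K₂ y) ∂ν := by
  rw [WFsq_eq h₁ h₂]
  refine lintegral_congr_ae ?_
  filter_upwards [n₁, n₂] with y e₁ e₂
  exact W2sq_eq_transportCost_truncCost hXD e₁ e₂

lemma WFsq_le (hX : MeasurableSet X) (hXD : ∀ a ∈ X, ∀ b ∈ X, edist a b ≤ D)
    (hμ : μ Xᶜ = 0) {ρ₁ ρ₂ : Measure (α × β)} (h₁ : ρ₁ ∈ Couplings μ ν)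
    (h₂ : ρ₂ ∈ Couplings μ ν) : WFsq ν ρ₁ ρ₂ ≤ D ^ 2 := by
  obtain ⟨K₁, hK₁, n₁⟩ := exists_isDisint_of_mem_couplings hX hμ h₁
  obtain ⟨K₂, hK₂, n₂⟩ := exists_isDisint_of_mem_couplings hX hμ h₂
  rw [WFsq_eq_lintegral_truncCost hXD hK₁ hK₂ n₁ n₂]
  have := hK₁.1
  have := hK₂.1
  calc _ ≤ ∫⁻ _, D ^ 2 ∂ν := by
        gcongr; exact transportCost_le_const (truncCost_le D) _ _
    _ = D ^ 2 := by rw [lintegral_const, measure_univ, mul_one]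

lemma WFsq_midpoint_le [TopologicalSpace.SeparableSpace α] [OpensMeasurableSpace α]
    (hX : MeasurableSet X) (hD : D ≠ ⊤) (hXD : ∀ a ∈ X, ∀ b ∈ X, edist a b ≤ D)
    (hμ : μ Xᶜ = 0) {ρ ρ' σ : Measure (α × β)} (h : ρ ∈ Couplings μ ν)
    (h' : ρ' ∈ Couplings μ ν) (hσ : σ ∈ Couplings μ ν) :
    WFsq ν ((2⁻¹ : ℝ≥0∞) • (ρ + ρ')) σ ≤ 2⁻¹ * (WFsq ν ρ σ + WFsq ν ρ' σ) := by
  obtain ⟨K, hK, n⟩ := exists_isDisint_of_mem_couplings hX hμ h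
  obtain ⟨K', hK', n'⟩ := exists_isDisint_of_mem_couplings hX hμ h'
  obtain ⟨S, hS, nS⟩ := exists_isDisint_of_mem_couplings hX hμ hσ
  obtain ⟨L, hL, hLe⟩ := hK.midpoint hK'
  have nL : ∀ᵐ y ∂ν, L y Xᶜ = 0 := by
    filter_upwards [n, n'] with y e e'
    simp [hLe, e, e']
  have := hK.1
  have := hK'.1
  have := hS.1
  have hm := measurable_transportCost (ENNReal.pow_ne_top hD) (truncCost_le D)
    (fun ε hε => exists_partition_truncCost_le hD hε) K S
  have hm' := measurable_transportCost (ENNReal.pow_ne_top hD) (truncCost_le D)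
    (fun ε hε => exists_partition_truncCost_le hD hε) K' S
  have hmm : Measurable fun y => transportCost (truncCost D) (K y) (S y)
      + transportCost (truncCost D) (K' y) (S y) := hm.add hm'
  rw [WFsq_eq_lintegral_truncCost hXD hK hS n nS,
    WFsq_eq_lintegral_truncCost hXD hK' hS n' nS,
    WFsq_eq_lintegral_truncCost hXD hL hS nL nS, ← lintegral_add_left hm,
    ← lintegral_const_mul _ hmm]
  gcongr with y
  rw [hLe]
  exact transportCost_convex _ _ _ _

lemma WFsq_withDensity_le (hX : MeasurableSet X) (hXD : ∀ a ∈ X, ∀ b ∈ X, edist a b ≤ D)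
    (hμ : μ Xᶜ = 0) {l : Measure α} [IsFiniteMeasure l] {f f' : α × β → ℝ≥0∞}
    (hf : Measurable f) (hf' : Measurable f')
    (h : (l.prod ν).withDensity f ∈ Couplings μ ν)
    (h' : (l.prod ν).withDensity f' ∈ Couplings μ ν)
    {σ : Measure (α × β)} (hσ : σ ∈ Couplings μ ν) :
    WFsq ν ((l.prod ν).withDensity f) σ
      ≤ WFsq ν ((l.prod ν).withDensity f') σ + D ^ 2 * ∫⁻ p, (f' p - f p) ∂(l.prod ν) := by
  obtain ⟨K, hK, n⟩ := exists_isDisint_of_mem_couplings hX hμ h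
  obtain ⟨K', hK', n'⟩ := exists_isDisint_of_mem_couplings hX hμ h'
  obtain ⟨S, hS, nS⟩ := exists_isDisint_of_mem_couplings hX hμ hσ
  have := hK.1
  have := hK'.1
  have := hS.1
  have hsub : Measurable fun p => f' p - f p := hf'.sub hf
  have hsub' : Measurable fun y => ∫⁻ x, (f' (x, y) - f (x, y)) ∂l := hsub.lintegral_prod_left'
  rw [WFsq_eq_lintegral_truncCost hXD hK hS n nS,
    WFsq_eq_lintegral_truncCost hXD hK' hS n' nS, lintegral_prod_symm _ hsub.aemeasurable,
    ← lintegral_const_mul _ hsub', ← lintegral_add_right _ (hsub'.const_mul _)]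
  refine lintegral_mono_ae ?_
  filter_upwards [hK.ae_eq_withDensity hf h.2.2, hK'.ae_eq_withDensity hf' h'.2.2] with y e e'
  have i1 : IsProbabilityMeasure (l.withDensity fun x => f (x, y)) := by
    rw [← e]; infer_instance
  have i2 : IsProbabilityMeasure (l.withDensity fun x => f' (x, y)) := by
    rw [← e']; infer_instance
  rw [e, e']
  exact transportCost_withDensity_le (truncCost_le D) (f := fun x => f (x, y))
    (f' := fun x => f' (x, y)) (hf.comp measurable_prodMk_right)
    (hf'.comp measurable_prodMk_right) (S y)

end FiberedWasserstein

section Entropy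

lemma continuous_entT : Continuous entT := by
  unfold entT
  exact (Real.continuous_mul_log.sub continuous_id).add continuous_const

lemma entT_nonneg {s : ℝ} (hs : 0 ≤ s) : 0 ≤ entT s := by
  unfold entT
  rcases hs.eq_or_lt with rfl | h
  · simp
  · have h1 := Real.one_sub_inv_le_log_of_pos h
    have h2 : s * (1 - s⁻¹) ≤ s * Real.log s := by gcongr
    have h3 : s * (1 - s⁻¹) = s - 1 := by field_simp
    linarith

lemma entT_le {s : ℝ} (hs : 0 ≤ s) : entT s ≤ s ^ 2 + 1 := by
  unfold entT
  have h1 : Real.log s ≤ s := Real.log_le_self hs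
  nlinarith [mul_le_mul_of_nonneg_left h1 hs]

lemma two_mul_sub_le_mul_log {p q : ℝ} (hp : 0 ≤ p) (hq : 0 < q) :
    2 * (p ^ 2 - p * q) ≤ p ^ 2 * Real.log (p ^ 2) - p ^ 2 * Real.log (q ^ 2) := by
  rcases hp.eq_or_lt with rfl | hp
  · simp
  have h1 := Real.log_le_sub_one_of_pos (div_pos hq hp)
  rw [Real.log_div hq.ne' hp.ne'] at h1
  have h2 : p ^ 2 * (Real.log q - Real.log p) ≤ p ^ 2 * (q / p - 1) := by gcongr
  have h3 : p ^ 2 * (q / p - 1) = p * q - p ^ 2 := by field_simp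
  rw [Real.log_pow, Real.log_pow]
  push_cast
  linarith

/-- Quantitative midpoint convexity of the entropy integrand. -/
lemma entT_midpoint_le {a b : ℝ} (ha : 0 ≤ a) (hb : 0 ≤ b) (η : ℝ) :
    entT ((a + b) / 2) + η / 2 * |a - b| ≤ (entT a + entT b) / 2 + η ^ 2 / 2 * (a + b) := by
  obtain ⟨p, hp, rfl⟩ : ∃ p, 0 ≤ p ∧ a = p ^ 2 := ⟨√a, Real.sqrt_nonneg _, (Real.sq_sqrt ha).symm⟩
  obtain ⟨q, hq, rfl⟩ : ∃ q, 0 ≤ q ∧ b = q ^ 2 := ⟨√b, Real.sqrt_nonneg _, (Real.sq_sqrt hb).symm⟩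
  obtain ⟨s, hs, hs2⟩ : ∃ s, 0 ≤ s ∧ (p ^ 2 + q ^ 2) / 2 = s ^ 2 :=
    ⟨√((p ^ 2 + q ^ 2) / 2), Real.sqrt_nonneg _, (Real.sq_sqrt (by positivity)).symm⟩
  have habs : |p ^ 2 - q ^ 2| = |p - q| * (p + q) := by
    rw [show p ^ 2 - q ^ 2 = (p - q) * (p + q) by ring, abs_mul, abs_of_nonneg (add_nonneg hp hq)]
  have hyoung : η / 2 * |p ^ 2 - q ^ 2| ≤ (p - q) ^ 2 / 4 + η ^ 2 / 2 * (p ^ 2 + q ^ 2) := by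
    rw [habs, ← sq_abs (p - q)]
    nlinarith [sq_nonneg (|p - q| - η * (p + q)), mul_nonneg (sq_nonneg η) (sq_nonneg (p - q))]
  have hdef : entT ((p ^ 2 + q ^ 2) / 2) + (p - q) ^ 2 / 4
      ≤ (entT (p ^ 2) + entT (q ^ 2)) / 2 := by
    rw [hs2]
    rcases hs.eq_or_lt with rfl | hs
    · have hp0 : p = 0 := by nlinarith [sq_nonneg p, sq_nonneg q]
      have hq0 : q = 0 := by nlinarith [sq_nonneg p, sq_nonneg q]
      simp [hp0, hq0]
    have h1 := two_mul_sub_le_mul_log hp hs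
    have h2 := two_mul_sub_le_mul_log hq hs
    unfold entT
    have h3 : (p ^ 2 + q ^ 2) * Real.log (s ^ 2) = 2 * s ^ 2 * Real.log (s ^ 2) := by
      rw [← hs2]; ring
    nlinarith [sq_nonneg (p + q - 2 * s)]
  linarith

variable {α : Type*} [MeasurableSpace α] {π : Measure α}

lemma entropyH_withDensity [SigmaFinite π] {g : α → ℝ} (hg : Measurable g) (hg0 : ∀ p, 0 ≤ g p) :
    entropyH π (π.withDensity fun p => ENNReal.ofReal (g p))
      = ∫⁻ p, ENNReal.ofReal (entT (g p)) ∂π := by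
  rw [entropyH, if_pos (withDensity_absolutelyContinuous _ _)]
  refine lintegral_congr_ae ?_
  filter_upwards [Measure.rnDeriv_withDensity π hg.ennreal_ofReal] with p hp
  rw [hp, ENNReal.toReal_ofReal (hg0 p)]

lemma exists_eq_withDensity_ofReal [SigmaFinite π] {ρ : Measure α} [IsFiniteMeasure ρ]
    (h : ρ ≪ π) : ∃ g : α → ℝ, Measurable g ∧ (∀ p, 0 ≤ g p) ∧
      ρ = π.withDensity fun p => ENNReal.ofReal (g p) := by
  refine ⟨fun p => (ρ.rnDeriv π p).toReal, (Measure.measurable_rnDeriv ρ π).ennreal_toReal,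
    fun p => ENNReal.toReal_nonneg, ?_⟩
  conv_lhs => rw [← Measure.withDensity_rnDeriv_eq ρ π h]
  refine withDensity_congr_ae ?_
  filter_upwards [Measure.rnDeriv_lt_top ρ π] with p hp
  rw [ENNReal.ofReal_toReal hp.ne]

lemma absolutelyContinuous_of_entropyH_ne_top {ρ : Measure α} (h : entropyH π ρ ≠ ⊤) : ρ ≪ π := by
  by_contra hac
  exact h (by rw [entropyH, if_neg hac])

lemma withDensity_ofReal_midpoint {g h : α → ℝ} (hg : Measurable g)
    (hg0 : ∀ p, 0 ≤ g p) (hh : Measurable h) (hh0 : ∀ p, 0 ≤ h p) :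
    π.withDensity (fun p => ENNReal.ofReal ((g p + h p) / 2))
      = (2⁻¹ : ℝ≥0∞) • (π.withDensity (fun p => ENNReal.ofReal (g p))
        + π.withDensity fun p => ENNReal.ofReal (h p)) := by
  rw [← withDensity_add_left hg.ennreal_ofReal, ← withDensity_smul _
    (hg.ennreal_ofReal.add hh.ennreal_ofReal)]
  congr 1
  funext p
  simp only [Pi.smul_apply, Pi.add_apply, smul_eq_mul]
  rw [← ENNReal.ofReal_add (hg0 p) (hh0 p), div_eq_inv_mul, ENNReal.ofReal_mul (by norm_num),
    ENNReal.ofReal_inv_of_pos (by norm_num), ENNReal.ofReal_ofNat]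

lemma eLpNorm_one_sub (g h : α → ℝ) :
    eLpNorm (g - h) 1 π = ∫⁻ p, ENNReal.ofReal |g p - h p| ∂π := by
  rw [eLpNorm_one_eq_lintegral_enorm]
  refine lintegral_congr fun p => ?_
  rw [Pi.sub_apply, ← ofReal_norm, Real.norm_eq_abs]

/-- Integrated quantitative midpoint convexity of the entropy. -/
lemma lintegral_entT_midpoint_le {g h : α → ℝ} (hg : Measurable g) (hg0 : ∀ p, 0 ≤ g p)
    (hh : Measurable h) (hh0 : ∀ p, 0 ≤ h p)
    (hg1 : ∫⁻ p, ENNReal.ofReal (g p) ∂π = 1) (hh1 : ∫⁻ p, ENNReal.ofReal (h p) ∂π = 1)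
    {η : ℝ} (hη : 0 ≤ η) :
    (∫⁻ p, ENNReal.ofReal (entT ((g p + h p) / 2)) ∂π)
        + ENNReal.ofReal (η / 2) * eLpNorm (g - h) 1 π
      ≤ 2⁻¹ * ((∫⁻ p, ENNReal.ofReal (entT (g p)) ∂π) + ∫⁻ p, ENNReal.ofReal (entT (h p)) ∂π)
        + ENNReal.ofReal (η ^ 2) := by
  have mg : Measurable fun p => ENNReal.ofReal (entT (g p)) :=
    (continuous_entT.measurable.comp hg).ennreal_ofReal
  have mh : Measurable fun p => ENNReal.ofReal (entT (h p)) :=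
    (continuous_entT.measurable.comp hh).ennreal_ofReal
  have mabs : Measurable fun p => ENNReal.ofReal |g p - h p| :=
    (continuous_abs.measurable.comp (hg.sub hh)).ennreal_ofReal
  have msum : Measurable fun p => ENNReal.ofReal (g p) + ENNReal.ofReal (h p) :=
    hg.ennreal_ofReal.add hh.ennreal_ofReal
  have msum' : Measurable fun p => ENNReal.ofReal (entT (g p)) + ENNReal.ofReal (entT (h p)) :=
    mg.add mh
  have hr : ENNReal.ofReal (η ^ 2)
      = ∫⁻ p, ENNReal.ofReal (η ^ 2 / 2) * (ENNReal.ofReal (g p) + ENNReal.ofReal (h p)) ∂π := by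
    rw [lintegral_const_mul _ msum, lintegral_add_left hg.ennreal_ofReal, hg1, hh1,
      one_add_one_eq_two, ← ENNReal.ofReal_ofNat 2, ← ENNReal.ofReal_mul (by positivity)]
    congr 1; ring
  rw [eLpNorm_one_sub, hr, ← lintegral_const_mul _ mabs, ← lintegral_add_left mg,
    ← lintegral_const_mul _ msum', ← lintegral_add_right _ (mabs.const_mul _),
    ← lintegral_add_right _ (msum.const_mul _)]
  refine lintegral_mono fun p => ?_
  have h2 : (2⁻¹ : ℝ≥0∞) = ENNReal.ofReal 2⁻¹ := by
    rw [ENNReal.ofReal_inv_of_pos (by norm_num), ENNReal.ofReal_ofNat]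
  have e1 := entT_nonneg (hg0 p)
  have e2 := entT_nonneg (hh0 p)
  have e3 : 0 ≤ entT ((g p + h p) / 2) :=
    entT_nonneg (div_nonneg (add_nonneg (hg0 p) (hh0 p)) (by norm_num))
  rw [h2, ← ENNReal.ofReal_add e1 e2, ← ENNReal.ofReal_add (hg0 p) (hh0 p),
    ← ENNReal.ofReal_mul (by positivity), ← ENNReal.ofReal_mul (by positivity),
    ← ENNReal.ofReal_mul (by positivity), ← ENNReal.ofReal_add e3 (by positivity),
    ← ENNReal.ofReal_add (by positivity)
      (mul_nonneg (by positivity) (add_nonneg (hg0 p) (hh0 p)))]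
  refine ENNReal.ofReal_le_ofReal ?_
  have := entT_midpoint_le (hg0 p) (hh0 p) η
  linarith

lemma withDensity_ofReal_apply_le {g h : α → ℝ} (hh : Measurable h) {s : Set α}
    (hs : MeasurableSet s) :
    π.withDensity (fun p => ENNReal.ofReal (g p)) s
      ≤ π.withDensity (fun p => ENNReal.ofReal (h p)) s + eLpNorm (g - h) 1 π := by
  rw [eLpNorm_one_sub, withDensity_apply _ hs, withDensity_apply _ hs]
  calc ∫⁻ p in s, ENNReal.ofReal (g p) ∂π
      ≤ ∫⁻ p in s, (ENNReal.ofReal (h p) + ENNReal.ofReal |g p - h p|) ∂π := by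
        gcongr with p
        refine (ENNReal.ofReal_le_ofReal (?_ : g p ≤ h p + |g p - h p|)).trans ENNReal.ofReal_add_le
        linarith [le_abs_self (g p - h p)]
    _ = (∫⁻ p in s, ENNReal.ofReal (h p) ∂π) + ∫⁻ p in s, ENNReal.ofReal |g p - h p| ∂π :=
        lintegral_add_left hh.ennreal_ofReal _
    _ ≤ _ := by gcongr; exact Measure.restrict_le_self

end Entropy

section Energy

variable {α β : Type*} [MeasurableSpace α] [MeasurableSpace β]

lemma midpoint_mem_couplings {μ : Measure α} {ν : Measure β} {ρ ρ' : Measure (α × β)}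
    (h : ρ ∈ Couplings μ ν) (h' : ρ' ∈ Couplings μ ν) :
    (2⁻¹ : ℝ≥0∞) • (ρ + ρ') ∈ Couplings μ ν := by
  have half : (2⁻¹ : ℝ≥0∞) * (1 + 1) = 1 := by
    rw [one_add_one_eq_two]; exact ENNReal.inv_mul_cancel (by simp) (by simp)
  refine ⟨⟨?_⟩, ?_, ?_⟩
  · have := h.1
    have := h'.1
    simp [ENNReal.inv_two_add_inv_two]
  · rw [Measure.map_smul, Measure.map_add _ _ measurable_fst, h.2.1, h'.2.1]
    ext s
    simp only [Measure.smul_apply, Measure.add_apply, smul_eq_mul]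
    rw [← one_mul (μ s), ← add_mul, ← mul_assoc, half]
  · rw [Measure.map_smul, Measure.map_add _ _ measurable_snd, h.2.2, h'.2.2]
    ext s
    simp only [Measure.smul_apply, Measure.add_apply, smul_eq_mul]
    rw [← one_mul (ν s), ← add_mul, ← mul_assoc, half]

/-- The nonnegative measurable densities with respect to `π` of transport plans. -/
def couplingDensities (π : Measure (α × β)) (μ : Measure α) (ν : Measure β) : Set (α × β → ℝ) :=
  {g | Measurable g ∧ (∀ p, 0 ≤ g p) ∧
    π.withDensity (fun p => ENNReal.ofReal (g p)) ∈ Couplings μ ν}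

variable {μ : Measure α} {ν : Measure β} {π : Measure (α × β)} {g h : α × β → ℝ}

lemma lintegral_ofReal_of_mem_couplingDensities (hg : g ∈ couplingDensities π μ ν) :
    ∫⁻ p, ENNReal.ofReal (g p) ∂π = 1 := by
  have := hg.2.2.1
  rw [← setLIntegral_univ, ← withDensity_apply _ .univ, measure_univ]

lemma midpoint_mem_couplingDensities (hg : g ∈ couplingDensities π μ ν)
    (hh : h ∈ couplingDensities π μ ν) :
    (fun p => (g p + h p) / 2) ∈ couplingDensities π μ ν := by
  refine ⟨(hg.1.add hh.1).div_const 2, fun p => div_nonneg (add_nonneg (hg.2.1 p) (hh.2.1 p))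
    (by norm_num), ?_⟩
  rw [withDensity_ofReal_midpoint hg.1 hg.2.1 hh.1 hh.2.1]
  exact midpoint_mem_couplings hg.2.2 hh.2.2

lemma memLp_one_of_mem_couplingDensities (hg : g ∈ couplingDensities π μ ν) : MemLp g 1 π := by
  refine ⟨hg.1.aestronglyMeasurable, ?_⟩
  have h0 := eLpNorm_one_sub (π := π) g 0
  simp only [sub_zero, Pi.zero_apply, abs_of_nonneg (hg.2.1 _),
    lintegral_ofReal_of_mem_couplingDensities hg] at h0
  simp [h0]

lemma eq_withDensity_of_tendsto {ι : Type*} {F : Filter ι} [F.NeBot] {u : ι → α × β → ℝ}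
    (hu : ∀ n, Measurable (u n)) (hg : Measurable g)
    (hlim : Tendsto (fun n => eLpNorm (u n - g) 1 π) F (𝓝 0)) {s : Set (α × β)}
    (hs : MeasurableSet s) {b : ℝ≥0∞}
    (hb : ∀ n, π.withDensity (fun p => ENNReal.ofReal (u n p)) s = b) :
    π.withDensity (fun p => ENNReal.ofReal (g p)) s = b := by
  refine le_antisymm ?_ ?_
  · have : Tendsto (fun n => b + eLpNorm (u n - g) 1 π) F (𝓝 (b + 0)) := hlim.const_add b
    rw [add_zero] at this
    refine ge_of_tendsto' this fun n => ?_
    rw [← hb n, eLpNorm_sub_comm]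
    exact withDensity_ofReal_apply_le (hu n) hs
  · have : Tendsto (fun n => π.withDensity (fun p => ENNReal.ofReal (g p)) s
      + eLpNorm (u n - g) 1 π) F (𝓝 (π.withDensity (fun p => ENNReal.ofReal (g p)) s + 0)) :=
      hlim.const_add _
    rw [add_zero] at this
    refine ge_of_tendsto' this fun n => ?_
    rw [← hb n]
    exact withDensity_ofReal_apply_le hg hs

/-- Densities of transport plans are closed in `L¹`. -/
lemma mem_couplingDensities_of_tendsto {u : ℕ → α × β → ℝ}
    (hu : ∀ n, u n ∈ couplingDensities π μ ν) (hg : Measurable g) (hg0 : ∀ p, 0 ≤ g p)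
    (hlim : Tendsto (fun n => eLpNorm (u n - g) 1 π) atTop (𝓝 0)) :
    g ∈ couplingDensities π μ ν := by
  refine ⟨hg, hg0, ⟨?_⟩, ?_, ?_⟩
  · exact eq_withDensity_of_tendsto (fun n => (hu n).1) hg hlim .univ
      fun n => (hu n).2.2.1.measure_univ
  · ext s hs
    rw [Measure.map_apply measurable_fst hs]
    refine eq_withDensity_of_tendsto (fun n => (hu n).1) hg hlim (measurable_fst hs) fun n => ?_
    rw [← Measure.map_apply measurable_fst hs, (hu n).2.2.2.1]
  · ext s hs
    rw [Measure.map_apply measurable_snd hs]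
    refine eq_withDensity_of_tendsto (fun n => (hu n).1) hg hlim (measurable_snd hs) fun n => ?_
    rw [← Measure.map_apply measurable_snd hs, (hu n).2.2.2.2]

/-- The `L¹`-limit of a sequence of densities of transport plans has a representative that is
again such a density. -/
lemma exists_mem_couplingDensities_of_cauchy {u : ℕ → α × β → ℝ}
    (hu : ∀ n, u n ∈ couplingDensities π μ ν) {B : ℕ → ℝ≥0∞} (hB : ∑' i, B i ≠ ⊤)
    (hc : ∀ N n k, N ≤ n → N ≤ k → eLpNorm (u n - u k) 1 π < B N) :
    ∃ g ∈ couplingDensities π μ ν, Tendsto (fun n => eLpNorm (u n - g) 1 π) atTop (𝓝 0) := by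
  obtain ⟨f, hf, hlim⟩ := Lp.cauchy_complete_eLpNorm le_rfl
    (fun n => memLp_one_of_mem_couplingDensities (hu n)) hB hc
  set f' := hf.1.mk f with hf'
  have hf'm : Measurable f' := hf.1.stronglyMeasurable_mk.measurable
  have hg : Measurable fun p => max (f' p) 0 := hf'm.max measurable_const
  have hlim' : Tendsto (fun n => eLpNorm (u n - fun p => max (f' p) 0) 1 π) atTop (𝓝 0) := by
    refine tendsto_of_tendsto_of_tendsto_of_le_of_le tendsto_const_nhds hlim
      (fun _ => zero_le) fun n => ?_
    refine eLpNorm_mono_ae ?_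
    filter_upwards [hf.1.ae_eq_mk] with p hp
    rw [Pi.sub_apply, Pi.sub_apply, hp, Real.norm_eq_abs, Real.norm_eq_abs]
    conv_lhs => rw [← max_eq_left ((hu n).2.1 p)]
    exact abs_max_sub_max_le_abs _ _ _
  exact ⟨_, mem_couplingDensities_of_tendsto hu hg (fun p => le_max_right _ _) hlim', hlim'⟩

end Energy

section Energy

variable {α β : Type*} [MeasurableSpace α] [MeasurableSpace β] [PseudoEMetricSpace α]

/-- The functional `ρ ↦ a W_F(ρ, σ)² + ∫ v dρ + k H(ρ | l ⊗ ν)`. -/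
def stepEnergy (a k : ℝ≥0∞) (v : α × β → ℝ≥0∞) (l : Measure α) (ν : Measure β)
    (σ ρ : Measure (α × β)) : ℝ≥0∞ :=
  a * WFsq ν ρ σ + (∫⁻ p, v p ∂ρ) + k * entropyH (l.prod ν) ρ

variable {a k : ℝ≥0∞} {v : α × β → ℝ≥0∞} {l : Measure α} [IsFiniteMeasure l] {ν : Measure β}
  [IsProbabilityMeasure ν] {σ : Measure (α × β)} {X : Set α} {D : ℝ≥0∞} {μ : Measure α}
  {g h : α × β → ℝ}

lemma stepEnergy_withDensity (hv : Measurable v) (hg : Measurable g) (hg0 : ∀ p, 0 ≤ g p) :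
    stepEnergy a k v l ν σ ((l.prod ν).withDensity fun p => ENNReal.ofReal (g p))
      = a * WFsq ν ((l.prod ν).withDensity fun p => ENNReal.ofReal (g p)) σ
        + ∫⁻ p, (ENNReal.ofReal (g p) * v p + k * ENNReal.ofReal (entT (g p))) ∂(l.prod ν) := by
  have m1 : Measurable fun p => ENNReal.ofReal (g p) * v p := hg.ennreal_ofReal.mul hv
  have m2 : Measurable fun p => ENNReal.ofReal (entT (g p)) :=
    (continuous_entT.measurable.comp hg).ennreal_ofReal
  rw [stepEnergy, entropyH_withDensity hg hg0, lintegral_add_left m1, lintegral_const_mul _ m2,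
    lintegral_withDensity_eq_lintegral_mul _ hg.ennreal_ofReal hv, add_assoc]
  rfl

variable [StandardBorelSpace α] [Nonempty α]

section Convexity

variable [TopologicalSpace.SeparableSpace α] [OpensMeasurableSpace α]

lemma stepEnergy_midpoint_le (hX : MeasurableSet X) (hD : D ≠ ⊤)
    (hXD : ∀ a ∈ X, ∀ b ∈ X, edist a b ≤ D) (hμ : μ Xᶜ = 0) (hσ : σ ∈ Couplings μ ν)
    (hg : g ∈ couplingDensities (l.prod ν) μ ν) (hh : h ∈ couplingDensities (l.prod ν) μ ν)
    {η : ℝ} (hη : 0 ≤ η) :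
    stepEnergy a k v l ν σ ((l.prod ν).withDensity fun p => ENNReal.ofReal ((g p + h p) / 2))
        + k * (ENNReal.ofReal (η / 2) * eLpNorm (g - h) 1 (l.prod ν))
      ≤ 2⁻¹ * (stepEnergy a k v l ν σ ((l.prod ν).withDensity fun p => ENNReal.ofReal (g p))
          + stepEnergy a k v l ν σ ((l.prod ν).withDensity fun p => ENNReal.ofReal (h p)))
        + k * ENNReal.ofReal (η ^ 2) := by
  have hW := WFsq_midpoint_le hX hD hXD hμ hg.2.2 hh.2.2 hσ
  have hE := lintegral_entT_midpoint_le hg.1 hg.2.1 hh.1 hh.2.1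
    (lintegral_ofReal_of_mem_couplingDensities hg)
    (lintegral_ofReal_of_mem_couplingDensities hh) hη
  have hmid := midpoint_mem_couplingDensities hg hh
  rw [← entropyH_withDensity hg.1 hg.2.1, ← entropyH_withDensity hh.1 hh.2.1,
    ← entropyH_withDensity hmid.1 hmid.2.1] at hE
  simp only [stepEnergy]
  rw [withDensity_ofReal_midpoint hg.1 hg.2.1 hh.1 hh.2.1] at hE ⊢
  rw [lintegral_smul_measure, lintegral_add_measure, smul_eq_mul]
  generalize (l.prod ν).withDensity (fun p => ENNReal.ofReal (g p)) = ρ at *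
  generalize (l.prod ν).withDensity (fun p => ENNReal.ofReal (h p)) = ρ' at *
  calc _ = a * WFsq ν ((2⁻¹ : ℝ≥0∞) • (ρ + ρ')) σ
          + 2⁻¹ * ((∫⁻ p, v p ∂ρ) + ∫⁻ p, v p ∂ρ')
          + k * (entropyH (l.prod ν) ((2⁻¹ : ℝ≥0∞) • (ρ + ρ'))
            + ENNReal.ofReal (η / 2) * eLpNorm (g - h) 1 (l.prod ν)) := by ring
    _ ≤ a * (2⁻¹ * (WFsq ν ρ σ + WFsq ν ρ' σ))
          + 2⁻¹ * ((∫⁻ p, v p ∂ρ) + ∫⁻ p, v p ∂ρ')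
          + k * (2⁻¹ * (entropyH (l.prod ν) ρ + entropyH (l.prod ν) ρ')
            + ENNReal.ofReal (η ^ 2)) := by gcongr
    _ = _ := by ring

/-- Almost minimizing densities are close to each other in `L¹`. -/
lemma eLpNorm_sub_le_of_stepEnergy_le (hX : MeasurableSet X) (hD : D ≠ ⊤)
    (hXD : ∀ a ∈ X, ∀ b ∈ X, edist a b ≤ D) (hμ : μ Xᶜ = 0) (hσ : σ ∈ Couplings μ ν)
    (hk0 : k ≠ 0) (hk : k ≠ ⊤)
    (hg : g ∈ couplingDensities (l.prod ν) μ ν) (hh : h ∈ couplingDensities (l.prod ν) μ ν)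
    {I : ℝ≥0∞} (hI : I ≠ ⊤) (hle : ∀ ρ ∈ Couplings μ ν, I ≤ stepEnergy a k v l ν σ ρ)
    {η : ℝ} (hη : 0 < η)
    (hgI : stepEnergy a k v l ν σ ((l.prod ν).withDensity fun p => ENNReal.ofReal (g p))
      ≤ I + k * ENNReal.ofReal (η ^ 2))
    (hhI : stepEnergy a k v l ν σ ((l.prod ν).withDensity fun p => ENNReal.ofReal (h p))
      ≤ I + k * ENNReal.ofReal (η ^ 2)) :
    eLpNorm (g - h) 1 (l.prod ν) ≤ ENNReal.ofReal (4 * η) := by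
  have h1 := stepEnergy_midpoint_le (a := a) (k := k) (v := v) hX hD hXD hμ hσ hg hh hη.le
  have h2 := hle _ (midpoint_mem_couplingDensities hg hh).2.2
  set N := eLpNorm (g - h) 1 (l.prod ν)
  have half : (2⁻¹ : ℝ≥0∞) * 2 = 1 := ENNReal.inv_mul_cancel (by simp) (by simp)
  have h3 : I + k * (ENNReal.ofReal (η / 2) * N) ≤ I + k * (2 * ENNReal.ofReal (η ^ 2)) :=
    calc I + k * (ENNReal.ofReal (η / 2) * N)
        ≤ 2⁻¹ * ((I + k * ENNReal.ofReal (η ^ 2)) + (I + k * ENNReal.ofReal (η ^ 2)))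
          + k * ENNReal.ofReal (η ^ 2) := (add_le_add_left h2 _).trans (h1.trans (by gcongr))
      _ = (2⁻¹ * 2) * (I + k * ENNReal.ofReal (η ^ 2)) + k * ENNReal.ofReal (η ^ 2) := by ring
      _ = _ := by rw [half]; ring
  rw [ENNReal.add_le_add_iff_left hI, ENNReal.mul_le_mul_iff_right hk0 hk] at h3
  have h4 : (2 : ℝ≥0∞) * ENNReal.ofReal (η ^ 2)
      = ENNReal.ofReal (η / 2) * ENNReal.ofReal (4 * η) := by
    rw [← ENNReal.ofReal_mul (by positivity), ← ENNReal.ofReal_ofNat 2,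
      ← ENNReal.ofReal_mul (by positivity)]
    congr 1; ring
  rwa [h4, ENNReal.mul_le_mul_iff_right (by simpa using hη) ENNReal.ofReal_ne_top] at h3

end Convexity

/-- Lower semicontinuity of the energy under `L¹` convergence of densities. -/
lemma stepEnergy_le_of_tendsto (hX : MeasurableSet X) (hD : D ≠ ⊤)
    (hXD : ∀ a ∈ X, ∀ b ∈ X, edist a b ≤ D) (hμ : μ Xᶜ = 0) (hσ : σ ∈ Couplings μ ν)
    (ha : a ≠ ⊤) (hk : k ≠ ⊤) (hv : Measurable v) (hvt : ∀ p, v p ≠ ⊤)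
    {u : ℕ → α × β → ℝ} (hu : ∀ n, u n ∈ couplingDensities (l.prod ν) μ ν)
    (hg : g ∈ couplingDensities (l.prod ν) μ ν)
    (hlim : Tendsto (fun n => eLpNorm (u n - g) 1 (l.prod ν)) atTop (𝓝 0))
    {B : ℕ → ℝ≥0∞} {I : ℝ≥0∞} (hB : Tendsto B atTop (𝓝 I))
    (huB : ∀ n, stepEnergy a k v l ν σ
      ((l.prod ν).withDensity fun p => ENNReal.ofReal (u n p)) ≤ B n) :
    stepEnergy a k v l ν σ ((l.prod ν).withDensity fun p => ENNReal.ofReal (g p)) ≤ I := by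
  obtain ⟨ns, hns, hae⟩ := (tendstoInMeasure_of_tendsto_eLpNorm one_ne_zero
    (fun n => (hu n).1.aestronglyMeasurable) hg.1.aestronglyMeasurable hlim).exists_seq_tendsto_ae
  rw [stepEnergy_withDensity hv hg.1 hg.2.1]
  set c := a * WFsq ν ((l.prod ν).withDensity fun p => ENNReal.ofReal (g p)) σ
  set P : (α × β → ℝ) → α × β → ℝ≥0∞ :=
    fun f p => ENNReal.ofReal (f p) * v p + k * ENNReal.ofReal (entT (f p)) with hP
  have hPm : ∀ n, Measurable (P (u n)) := fun n =>
    ((hu n).1.ennreal_ofReal.mul hv).add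
      ((continuous_entT.measurable.comp (hu n).1).ennreal_ofReal.const_mul k)
  have hFatou : ∫⁻ p, P g p ∂(l.prod ν)
      ≤ liminf (fun n => ∫⁻ p, P (u (ns n)) p ∂(l.prod ν)) atTop := by
    refine le_trans (le_of_eq ?_) (lintegral_liminf_le fun n => hPm (ns n))
    refine lintegral_congr_ae ?_
    filter_upwards [hae] with p hp
    refine (Tendsto.liminf_eq ?_).symm
    refine Tendsto.add ?_ ?_
    · exact ENNReal.Tendsto.mul_const (ENNReal.tendsto_ofReal hp) (Or.inr (hvt p))
    · exact ENNReal.Tendsto.const_mul (ENNReal.tendsto_ofReal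
        ((continuous_entT.tendsto _).comp hp)) (Or.inr hk)
  have hle : ∀ n, c + ∫⁻ p, P (u n) p ∂(l.prod ν)
      ≤ B n + a * D ^ 2 * eLpNorm (u n - g) 1 (l.prod ν) := by
    intro n
    have h1 := huB n
    rw [stepEnergy_withDensity hv (hu n).1 (hu n).2.1] at h1
    have h2 := WFsq_withDensity_le hX hXD hμ hg.1.ennreal_ofReal (hu n).1.ennreal_ofReal
      hg.2.2 (hu n).2.2 hσ
    have h3 : ∫⁻ p, (ENNReal.ofReal (u n p) - ENNReal.ofReal (g p)) ∂(l.prod ν)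
        ≤ eLpNorm (u n - g) 1 (l.prod ν) := by
      rw [eLpNorm_one_sub]
      gcongr with p
      rw [← ENNReal.ofReal_sub _ (hg.2.1 p)]
      exact ENNReal.ofReal_le_ofReal (le_abs_self _)
    calc c + ∫⁻ p, P (u n) p ∂(l.prod ν)
        ≤ a * (WFsq ν ((l.prod ν).withDensity fun p => ENNReal.ofReal (u n p)) σ
            + D ^ 2 * eLpNorm (u n - g) 1 (l.prod ν)) + ∫⁻ p, P (u n) p ∂(l.prod ν) :=
          add_le_add (mul_le_mul' le_rfl (h2.trans (by gcongr))) le_rfl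
      _ = a * WFsq ν ((l.prod ν).withDensity fun p => ENNReal.ofReal (u n p)) σ
            + (∫⁻ p, P (u n) p ∂(l.prod ν)) + a * D ^ 2 * eLpNorm (u n - g) 1 (l.prod ν) := by
          ring
      _ ≤ _ := by gcongr
  have hlim' : Tendsto (fun n => B (ns n) + a * D ^ 2 * eLpNorm (u (ns n) - g) 1 (l.prod ν))
      atTop (𝓝 (I + a * D ^ 2 * 0)) :=
    (hB.comp hns.tendsto_atTop).add (ENNReal.Tendsto.const_mul (hlim.comp hns.tendsto_atTop)
      (Or.inr (ENNReal.mul_ne_top ha (ENNReal.pow_ne_top hD))))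
  rw [mul_zero, add_zero] at hlim'
  calc c + ∫⁻ p, P g p ∂(l.prod ν)
      ≤ c + liminf (fun n => ∫⁻ p, P (u (ns n)) p ∂(l.prod ν)) atTop := by gcongr
    _ = liminf (fun n => c + ∫⁻ p, P (u (ns n)) p ∂(l.prod ν)) atTop :=
        (liminf_const_add _ _ _ (by isBoundedDefault) (by isBoundedDefault)).symm
    _ ≤ liminf (fun n => B (ns n) + a * D ^ 2 * eLpNorm (u (ns n) - g) 1 (l.prod ν)) atTop :=
        liminf_le_liminf (Eventually.of_forall fun n => hle (ns n))
    _ = I := hlim'.liminf_eq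

end Energy

section Minimizer

variable {α β : Type*} [MeasurableSpace α] [MeasurableSpace β] [PseudoEMetricSpace α]
  [StandardBorelSpace α] [Nonempty α] [TopologicalSpace.SeparableSpace α] [OpensMeasurableSpace α]
  {a k : ℝ≥0∞} {v : α × β → ℝ≥0∞} {l : Measure α} [IsFiniteMeasure l] {ν : Measure β}
  [IsProbabilityMeasure ν] {σ : Measure (α × β)} {X : Set α} {D : ℝ≥0∞} {μ : Measure α}

omit [StandardBorelSpace α] [Nonempty α] [TopologicalSpace.SeparableSpace α]
  [OpensMeasurableSpace α] in
lemma exists_couplingDensity_of_stepEnergy_ne_top (hk0 : k ≠ 0) {ρ : Measure (α × β)}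
    (hρ : ρ ∈ Couplings μ ν) (h : stepEnergy a k v l ν σ ρ ≠ ⊤) :
    ∃ g ∈ couplingDensities (l.prod ν) μ ν,
      ρ = (l.prod ν).withDensity fun p => ENNReal.ofReal (g p) := by
  have := hρ.1
  have h1 : k * entropyH (l.prod ν) ρ ≠ ⊤ := (ENNReal.add_ne_top.1 h).2
  have h2 : entropyH (l.prod ν) ρ ≠ ⊤ := fun e => h1 (by rw [e, ENNReal.mul_top hk0])
  obtain ⟨g, hg, hg0, rfl⟩ :=
    exists_eq_withDensity_ofReal (absolutelyContinuous_of_entropyH_ne_top h2)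
  exact ⟨g, ⟨hg, hg0, hρ⟩, rfl⟩

lemma existsUnique_minimizer_stepEnergy (hX : MeasurableSet X) (hD : D ≠ ⊤)
    (hXD : ∀ a ∈ X, ∀ b ∈ X, edist a b ≤ D) (hμ : μ Xᶜ = 0) (hσ : σ ∈ Couplings μ ν)
    (ha : a ≠ ⊤) (hk0 : k ≠ 0) (hk : k ≠ ⊤) (hv : Measurable v) (hvt : ∀ p, v p ≠ ⊤)
    (hfin : ∃ ρ ∈ Couplings μ ν, stepEnergy a k v l ν σ ρ ≠ ⊤) :
    ∃! ρ : Measure (α × β), ρ ∈ Couplings μ ν ∧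
      ∀ ρ' ∈ Couplings μ ν, stepEnergy a k v l ν σ ρ ≤ stepEnergy a k v l ν σ ρ' := by
  set I : ℝ≥0∞ := ⨅ ρ ∈ Couplings μ ν, stepEnergy a k v l ν σ ρ with hIdef
  have hle : ∀ ρ ∈ Couplings μ ν, I ≤ stepEnergy a k v l ν σ ρ := fun ρ hρ => iInf₂_le ρ hρ
  have hI : I ≠ ⊤ := by
    obtain ⟨ρ, hρ, hρt⟩ := hfin
    exact ne_top_of_le_ne_top hρt (hle ρ hρ)
  have hex : ∀ ε : ℝ≥0∞, ε ≠ 0 → ∃ g ∈ couplingDensities (l.prod ν) μ ν,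
      stepEnergy a k v l ν σ ((l.prod ν).withDensity fun p => ENNReal.ofReal (g p)) ≤ I + ε := by
    intro ε hε
    have hlt : I < I + ε := ENNReal.lt_add_right hI hε
    obtain ⟨ρ, hρ, hρI⟩ : ∃ ρ ∈ Couplings μ ν, stepEnergy a k v l ν σ ρ < I + ε := by
      simpa only [hIdef, iInf_lt_iff, exists_prop] using hlt
    obtain ⟨g, hg, rfl⟩ := exists_couplingDensity_of_stepEnergy_ne_top hk0 hρ
      (ne_top_of_lt hρI)
    exact ⟨g, hg, hρI.le⟩
  set η : ℕ → ℝ := fun n => (1 / 2) ^ n / 8 with hη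
  have hη0 : ∀ n, 0 < η n := fun n => by positivity
  have hηanti : Antitone η := fun i j hij =>
    div_le_div_of_nonneg_right (pow_le_pow_of_le_one (by norm_num) (by norm_num) hij)
      (by norm_num)
  have hηlim : Tendsto η atTop (𝓝 0) := by
    have := (tendsto_pow_atTop_nhds_zero_of_lt_one (r := (1 / 2 : ℝ)) (by norm_num)
      (by norm_num)).div_const 8
    rwa [zero_div] at this
  choose u hu huI using fun n => hex (k * ENNReal.ofReal (η n ^ 2))
    (mul_ne_zero hk0 (by simpa using (hη0 n).ne'))
  have hcauchy : ∀ N n m, N ≤ n → N ≤ m →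
      eLpNorm (u n - u m) 1 (l.prod ν) < ENNReal.ofReal ((1 / 2) ^ N) := by
    intro N n m hn hm
    refine (eLpNorm_sub_le_of_stepEnergy_le hX hD hXD hμ hσ hk0 hk (hu n) (hu m) hI hle (hη0 N)
      ((huI n).trans ?_) ((huI m).trans ?_)).trans_lt ?_
    · have := hηanti hn
      have := hη0 n
      gcongr
    · have := hηanti hm
      have := hη0 m
      gcongr
    · rw [ENNReal.ofReal_lt_ofReal_iff (by positivity)]
      have : (0 : ℝ) < (1 / 2) ^ N := by positivity
      simp only [hη]
      linarith
  have hsum : ∑' N : ℕ, ENNReal.ofReal ((1 / 2) ^ N) ≠ ⊤ := by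
    rw [← ENNReal.ofReal_tsum_of_nonneg (fun n => by positivity) summable_geometric_two]
    exact ENNReal.ofReal_ne_top
  obtain ⟨g, hg, hlim⟩ := exists_mem_couplingDensities_of_cauchy hu hsum hcauchy
  have hB : Tendsto (fun n => I + k * ENNReal.ofReal (η n ^ 2)) atTop (𝓝 I) := by
    have h1 : Tendsto (fun n => ENNReal.ofReal (η n ^ 2)) atTop (𝓝 0) := by
      simpa using ENNReal.tendsto_ofReal (hηlim.pow 2)
    simpa using (ENNReal.Tendsto.const_mul h1 (Or.inr hk)).const_add I
  have hgI := stepEnergy_le_of_tendsto hX hD hXD hμ hσ ha hk hv hvt hu hg hlim hB huI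
  refine ⟨_, ⟨hg.2.2, fun ρ hρ => hgI.trans (hle ρ hρ)⟩, ?_⟩
  rintro ρ ⟨hρ, hρmin⟩
  have hρI : stepEnergy a k v l ν σ ρ ≤ I := le_iInf₂ hρmin
  obtain ⟨h, hh, rfl⟩ := exists_couplingDensity_of_stepEnergy_ne_top hk0 hρ
    (ne_top_of_le_ne_top hI hρI)
  have hzero : eLpNorm (h - g) 1 (l.prod ν) = 0 := by
    have h0 : Tendsto (fun n => ENNReal.ofReal (4 * η n)) atTop (𝓝 0) := by
      simpa using ENNReal.tendsto_ofReal (hηlim.const_mul 4)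
    refine le_antisymm (ge_of_tendsto' h0 fun n => ?_) zero_le
    exact eLpNorm_sub_le_of_stepEnergy_le hX hD hXD hμ hσ hk0 hk hh hg hI hle (hη0 n)
      (hρI.trans le_self_add) (hgI.trans le_self_add)
  rw [eLpNorm_eq_zero_iff (hh.1.sub hg.1).aestronglyMeasurable one_ne_zero] at hzero
  refine withDensity_congr_ae ?_
  filter_upwards [hzero] with p hp
  rw [sub_eq_zero.1 hp]

end Minimizer

/-- for `V ∈ C²(X×Y)` nonnegative, `κ, τ > 0`, `ν` a probability measure on `Y`,
`μ` a probability measure on `X` with Lebesgue density bounded above and away from zero, and any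
`ρ̄ ∈ Γ(μ,ν)`, the minimizing movement functional
`E_τ(ρ|ρ̄) = (1/2τ) W_F(ρ,ρ̄)² + ∫ V dρ + κ H(ρ|ν)` admits a unique minimizer over `Γ(μ,ν)`. -/
theorem stmt10 {d d' : ℕ} (U : Set (Euc d)) (X : Set (Euc d)) (Y : Set (Euc d'))
    (hU : IsOpen U) (hUb : Bornology.IsBounded U) (hUconn : IsConnected U)
    (hXU : X = closure U)
    (hY : IsCompact Y) (hYne : Y.Nonempty)
    (V : Euc d × Euc d' → ℝ) (hV : ContDiff ℝ 2 V) (hV0 : ∀ p, 0 ≤ V p)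
    (κ : ℝ) (hκ : 0 < κ) (τ : ℝ) (hτ : 0 < τ)
    (ν : Measure (Euc d')) [IsProbabilityMeasure ν] (hνY : ν Yᶜ = 0)
    (m : Euc d → ℝ) (hmMeas : Measurable m)
    (c C : ℝ) (hc : 0 < c) (hmbound : ∀ x ∈ X, c ≤ m x ∧ m x ≤ C)
    (μ : Measure (Euc d)) [IsProbabilityMeasure μ]
    (hμ : μ = (volume.restrict X).withDensity (fun x => ENNReal.ofReal (m x)))
    (ρbar : Measure (Euc d × Euc d')) (hρbar : ρbar ∈ Couplings μ ν) :
    ∃! ρ : Measure (Euc d × Euc d'),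
      ρ ∈ Couplings μ ν ∧
        ∀ σ ∈ Couplings μ ν, JKOFun X ν V κ τ ρbar ρ ≤ JKOFun X ν V κ τ ρbar σ := by
  have hXc : IsCompact X := hXU ▸ hUb.isCompact_closure
  have hX : MeasurableSet X := hXc.measurableSet
  have : IsFiniteMeasure ((volume : Measure (Euc d)).restrict X) :=
    isFiniteMeasure_restrict.2 hXc.measure_ne_top
  have hμX : μ Xᶜ = 0 := by
    rw [hμ]
    exact withDensity_absolutelyContinuous _ _ (by rw [Measure.restrict_apply hX.compl]; simp)
  have hXD : ∀ a ∈ X, ∀ b ∈ X, edist a b ≤ ENNReal.ofReal (Metric.diam X) := by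
    intro a ha b hb
    rw [edist_dist]
    exact ENNReal.ofReal_le_ofReal (Metric.dist_le_diam_of_mem hXc.isBounded ha hb)
  have hprod : μ.prod ν ∈ Couplings μ ν := ⟨inferInstance, by simp, by simp⟩
  refine existsUnique_minimizer_stepEnergy (a := ENNReal.ofReal (1 / (2 * τ)))
    (k := ENNReal.ofReal κ) (v := fun p => ENNReal.ofReal (V p)) (l := volume.restrict X) hX
    ENNReal.ofReal_ne_top hXD hμX hρbar ENNReal.ofReal_ne_top (by simpa using hκ)
    ENNReal.ofReal_ne_top hV.continuous.measurable.ennreal_ofReal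
    (fun _ => ENNReal.ofReal_ne_top) ⟨μ.prod ν, hprod, ?_⟩
  refine ENNReal.add_ne_top.2 ⟨ENNReal.add_ne_top.2 ⟨ENNReal.mul_ne_top ENNReal.ofReal_ne_top
    (ne_top_of_le_ne_top (ENNReal.pow_ne_top ENNReal.ofReal_ne_top)
      (WFsq_le hX hXD hμX hprod hρbar)), ?_⟩, ENNReal.mul_ne_top ENNReal.ofReal_ne_top ?_⟩
  · obtain ⟨M, hM⟩ := (hXc.prod hY).bddAbove_image hV.continuous.continuousOn
    have hae : ∀ᵐ p ∂μ.prod ν, p ∈ X ×ˢ Y := by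
      filter_upwards [Measure.quasiMeasurePreserving_fst.ae (mem_ae_iff.2 hμX),
        Measure.quasiMeasurePreserving_snd.ae (mem_ae_iff.2 hνY)] with p h1 h2
      exact ⟨h1, h2⟩
    refine ne_top_of_le_ne_top (b := ∫⁻ _, ENNReal.ofReal M ∂μ.prod ν) (by simp)
      (lintegral_mono_ae ?_)
    filter_upwards [hae] with p hp
    exact ENNReal.ofReal_le_ofReal (hM (mem_image_of_mem V hp))
  · have hdens : μ.prod ν = ((volume.restrict X).prod ν).withDensity
        fun p => ENNReal.ofReal (max (m p.1) 0) := by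
      conv_lhs => rw [hμ]
      rw [prod_withDensity_left hmMeas.ennreal_ofReal]
      simp
    have hae : ∀ᵐ p ∂(volume.restrict X).prod ν, p.1 ∈ X :=
      Measure.quasiMeasurePreserving_fst.ae (ae_restrict_mem hX)
    have hmax : Measurable fun p : Euc d × Euc d' => max (m p.1) 0 :=
      (hmMeas.comp measurable_fst).max measurable_const
    have hconst : ∫⁻ _, ENNReal.ofReal (C ^ 2 + 1) ∂(volume.restrict X).prod ν ≠ ⊤ := by
      rw [lintegral_const]
      exact ENNReal.mul_ne_top ENNReal.ofReal_ne_top (measure_ne_top _ _)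
    rw [hdens, entropyH_withDensity hmax fun p => le_max_right _ _]
    refine ne_top_of_le_ne_top hconst (lintegral_mono_ae ?_)
    filter_upwards [hae] with p hp
    obtain ⟨h1, h2⟩ := hmbound _ hp
    have h3 : 0 ≤ m p.1 := hc.le.trans h1
    rw [max_eq_left h3]
    refine ENNReal.ofReal_le_ofReal ((entT_le h3).trans ?_)
    gcongr

end
end
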